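/- Let 𝒢 be a closed subgroup of Sym(P) containing Aut(P). Then 𝒢 is one of the following five groups: (1) 𝒢 = Aut(P); (2) 𝒢 = {f ∈ Sym(P) : for all a, b ∈ P, a ⊥ b ⟺ f(a) ⊥ f(b)}; (3) 𝒢 = {f ∈ Sym(P) : f preserves Cyc}; (4) 𝒢 = {f ∈ Sym(P) : f preserves Pari}; (5) 𝒢 = Sym(P). -/

import Mathlib

variable {P : Type} [PartialOrder P]

/-- `a` and `b` are incomparable elements of the partial order `P`. -/
def Perp (a b : P) : Prop := ¬ a ≤ b ∧ ¬ b ≤ a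

/-- `f` is an order-automorphism of `P`. -/
def IsOrderAuto (f : Equiv.Perm P) : Prop := ∀ a b : P, f a ≤ f b ↔ a ≤ b

/-- `f` is an anti-automorphism of `P`. -/
def IsAntiAuto (f : Equiv.Perm P) : Prop := ∀ a b : P, f a ≤ f b ↔ b ≤ a

/-- Every finite partial order embeds into `P` (universality). -/
def IsUniversal (P : Type) [PartialOrder P] : Prop :=
  ∀ (Q : Type) [PartialOrder Q] [Fintype Q], Nonempty (Q ↪o P)

/-- Every order-isomorphism between two finite subsets of `P` extends to an
order-automorphism of `P` (homogeneity). -/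
def IsHomogeneous (P : Type) [PartialOrder P] : Prop :=
  ∀ (S T : Finset P) (e : (S : Set P) ≃o (T : Set P)),
    ∃ g : P ≃o P, ∀ x : (S : Set P), g ↑x = ↑(e x)

/-- A subgroup of `Sym(P)` is closed iff it contains every permutation that agrees
with one of its members on each finite subset of `P`. -/
def IsClosedSubgroup (G : Subgroup (Equiv.Perm P)) : Prop :=
  ∀ f : Equiv.Perm P,
    (∀ S : Finset P, ∃ g ∈ G, ∀ x ∈ S, (g : Equiv.Perm P) x = f x) → f ∈ G

/-- `h` is an order-automorphism of `P` fixing each of the constants `c i`. -/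
def FixingAuto (n : ℕ) (c : Fin n → P) (h : Equiv.Perm P) : Prop :=
  IsOrderAuto h ∧ ∀ i : Fin n, h (c i) = c i

/-- `X` is an orbit of `(P, c₁, …, cₙ)`, i.e. an orbit of the action on `P` of the
group of automorphisms of `P` fixing each `c i`. -/
def IsOrbit (n : ℕ) (c : Fin n → P) (X : Set P) : Prop :=
  ∃ x : P, X = {y | ∃ h : Equiv.Perm P, FixingAuto n c h ∧ h x = y}

/-- `g` is canonical as a function from `(P, c₁, …, cₙ)` to `P`. -/
def Canonical (n : ℕ) (c : Fin n → P) (g : P → P) : Prop :=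
  ∀ (m : ℕ) (a b : Fin m → P),
    (∃ h : Equiv.Perm P, FixingAuto n c h ∧ ∀ j : Fin m, h (a j) = b j) →
    ∃ h' : Equiv.Perm P, IsOrderAuto h' ∧ ∀ j : Fin m, h' (g (a j)) = g (b j)

/-- `g` is M-generated by the subgroup `G` of `Sym(P)`: on every finite subset of `P`
it agrees with some member of `G`. -/
def MGen (G : Subgroup (Equiv.Perm P)) (g : P → P) : Prop :=
  ∀ S : Finset P, ∃ h ∈ G, ∀ x ∈ S, (h : Equiv.Perm P) x = g x

/-- `g` behaves like `id` on `X`. -/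
def BehavesLikeId (g : P → P) (X : Set P) : Prop :=
  ∀ x ∈ X, ∀ x' ∈ X, (x < x' → g x < g x') ∧ (Perp x x' → Perp (g x) (g x'))

/-- `g` behaves like `↕` on `X`. -/
def BehavesLikeRev (g : P → P) (X : Set P) : Prop :=
  ∀ x ∈ X, ∀ x' ∈ X, (x < x' → g x' < g x) ∧ (Perp x x' → Perp (g x) (g x'))

/-- `g` behaves like `id` between `X` and `Y`. -/
def BehavesLikeIdBetween (g : P → P) (X Y : Set P) : Prop :=
  ∀ x ∈ X, ∀ y ∈ Y,
    (x < y → g x < g y) ∧ (y < x → g y < g x) ∧ (Perp x y → Perp (g x) (g y))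

/-- `X ≤ Y` for subsets: some element of `X` lies below some element of `Y`. -/
def SetLE (X Y : Set P) : Prop := ∃ x ∈ X, ∃ y ∈ Y, x ≤ y

/-- `X < Y` for subsets: every element of `X` lies strictly below every element of `Y`. -/
def SetLT (X Y : Set P) : Prop := ∀ x ∈ X, ∀ y ∈ Y, x < y

/-- The relation `X ÷ Y`. -/
def SetDiv (X Y : Set P) : Prop :=
  (SetLE X Y ∧ ¬ SetLE Y X ∧ ¬ SetLT X Y) ∨ (SetLE Y X ∧ ¬ SetLE X Y ∧ ¬ SetLT Y X)

/-- `f` is a rotation of `P`. -/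
def IsRotation (f : Equiv.Perm P) : Prop :=
  ∃ X Y Z : Set P,
    (∀ p : P, p ∈ X ∨ p ∈ Y ∨ p ∈ Z) ∧
    Disjoint X Y ∧ Disjoint X Z ∧ Disjoint Y Z ∧
    IsLowerSet X ∧ IsUpperSet Z ∧
    (∀ x ∈ X, ∀ z ∈ Z, x < z) ∧
    BehavesLikeId (⇑f) X ∧ BehavesLikeId (⇑f) Y ∧ BehavesLikeId (⇑f) Z ∧
    (∀ x ∈ X, ∀ z ∈ Z, f z < f x) ∧
    (∀ x ∈ X, ∀ y ∈ Y, (f y < f x ↔ Perp x y) ∧ (Perp (f x) (f y) ↔ x < y)) ∧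
    (∀ y ∈ Y, ∀ z ∈ Z, (f z < f y ↔ Perp y z) ∧ (Perp (f y) (f z) ↔ y < z))

/-- The ternary relation `Cyc`. -/
def Cyc (a b c : P) : Prop :=
  (a < b ∧ b < c) ∨ (b < c ∧ c < a) ∨ (c < a ∧ a < b) ∨
  (a < b ∧ Perp c a ∧ Perp c b) ∨ (b < c ∧ Perp a b ∧ Perp a c) ∨
  (c < a ∧ Perp b a ∧ Perp b c)

/-- The ternary relation `Cyc'`, the dual of `Cyc`. -/
def Cyc' (a b c : P) : Prop := Cyc c b a

/-- The ternary relation `Pari`. -/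
def Pari (a b c : P) : Prop :=
  (Perp a b ∧ Perp b c ∧ Perp a c) ∨
  (a < b ∧ a < c ∧ Perp b c) ∨ (b < a ∧ b < c ∧ Perp a c) ∨ (c < a ∧ c < b ∧ Perp a b) ∨
  (b < a ∧ c < a ∧ Perp b c) ∨ (a < b ∧ c < b ∧ Perp a c) ∨ (a < c ∧ b < c ∧ Perp a b)

/-- `f` preserves the ternary relation `R`. -/
def Preserves3 (f : P → P) (R : P → P → P → Prop) : Prop :=
  ∀ a b c : P, R a b c ↔ R (f a) (f b) (f c)

/-- The reverse order on the same type. -/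
@[reducible] def dualPO (P : Type) [PartialOrder P] : PartialOrder P where
  le a b := b ≤ a
  lt a b := b < a
  le_refl := le_refl
  le_trans _ _ _ h h' := h'.trans h
  lt_iff_le_not_ge _ _ := lt_iff_le_not_ge
  le_antisymm _ _ h h' := h'.antisymm h

theorem perp_dual (a b : P) : @Perp P (dualPO P) a b ↔ Perp a b := and_comm

theorem Perp.symm {a b : P} (h : Perp a b) : Perp b a := ⟨h.2, h.1⟩

theorem perp_comm {a b : P} : Perp a b ↔ Perp b a := and_comm

theorem Perp.ne {a b : P} (h : Perp a b) : a ≠ b := fun e => h.1 e.le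

theorem not_perp_self (a : P) : ¬ Perp a a := fun h => h.1 le_rfl

theorem Perp.not_lt {a b : P} (h : Perp a b) : ¬ a < b := fun l => h.1 l.le

theorem not_perp_of_lt {a b : P} (h : a < b) : ¬ Perp a b := fun l => l.1 h.le

theorem not_perp_of_gt {a b : P} (h : b < a) : ¬ Perp a b := fun l => l.2 h.le

theorem perp_of_not {a b : P} (h : ¬ a < b) (h' : ¬ b < a) (n : a ≠ b) : Perp a b :=
  ⟨fun l => h (l.lt_of_ne n), fun l => h' (l.lt_of_ne n.symm)⟩

theorem lt_or_gt_of_not_perp {a b : P} (h : ¬ Perp a b) (n : a ≠ b) : a < b ∨ b < a := by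
  by_contra! c
  exact h (perp_of_not c.1 c.2 n)

/-- A family of pairwise incomparable elements. -/
def AC {ι : Type} (Y : ι → P) : Prop := ∀ i j, i ≠ j → Perp (Y i) (Y j)

theorem ac_dual {ι : Type} (Y : ι → P) : @AC P (dualPO P) ι Y ↔ AC Y := by
  simp only [AC, perp_dual]

theorem AC.injective {ι : Type} {Y : ι → P} (h : AC Y) : Function.Injective Y := by
  intro i j e
  by_contra n
  exact (h i j n).ne e

theorem AC.comp {ι κ : Type} {Y : ι → P} (h : AC Y) {f : κ → ι} (hf : Function.Injective f) :
    AC (Y ∘ f) := fun _ _ n => h _ _ (hf.ne n)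

theorem AC.le_iff {ι : Type} {Y : ι → P} (h : AC Y) {i j : ι} : Y i ≤ Y j ↔ i = j := by
  refine ⟨fun l => ?_, fun e => by rw [e]⟩
  by_contra n
  exact (h i j n).1 l

/-- The group `G` acts on an ultrahomogeneous universal order and contains its automorphisms. -/
structure Rich (G : Subgroup (Equiv.Perm P)) : Prop where
  hom : ∀ {ι : Type} [Finite ι] (a b : ι → P), (∀ i j, a i ≤ a j ↔ b i ≤ b j) →
    ∃ h ∈ G, IsOrderAuto h ∧ ∀ i, h (a i) = b i
  ext : ∀ {Q κ : Type} [PartialOrder Q] [Finite Q] [Finite κ] (e : κ → Q) (Z : κ → P),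
    (∀ i j, Z i ≤ Z j ↔ e i ≤ e j) →
    ∃ φ : Q → P, (∀ p q, φ p ≤ φ q ↔ p ≤ q) ∧ ∀ k, φ (e k) = Z k

theorem isOrderAuto_dual (f : Equiv.Perm P) : @IsOrderAuto P (dualPO P) f ↔ IsOrderAuto f :=
  ⟨fun h a b => h b a, fun h a b => h b a⟩

theorem IsOrderAuto.lt_iff {f : Equiv.Perm P} (h : IsOrderAuto f) {a b : P} :
    f a < f b ↔ a < b := by
  rw [lt_iff_le_not_ge, lt_iff_le_not_ge, h, h]

theorem IsOrderAuto.perp_iff {f : Equiv.Perm P} (h : IsOrderAuto f) {a b : P} :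
    Perp (f a) (f b) ↔ Perp a b := by
  unfold Perp
  rw [h, h]

theorem rich_of_universal_of_homogeneous (hU : IsUniversal P) (hH : IsHomogeneous P)
    (G : Subgroup (Equiv.Perm P)) (hAut : ∀ f : Equiv.Perm P, IsOrderAuto f → f ∈ G) :
    Rich G := by
  classical
  have hom : ∀ {ι : Type} [Finite ι] (a b : ι → P), (∀ i j, a i ≤ a j ↔ b i ≤ b j) →
      ∃ h ∈ G, IsOrderAuto h ∧ ∀ i, h (a i) = b i := by
    intro ι _ a b hab
    have := Fintype.ofFinite ι
    have hae : ∀ i j, a i = a j ↔ b i = b j := fun i j => by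
      rw [le_antisymm_iff, le_antisymm_iff, hab, hab]
    let S := Finset.univ.image a
    let T := Finset.univ.image b
    have hS : ∀ x : (S : Set P), ∃ i, a i = x := fun x => by
      have := x.2; simpa [S] using this
    have hT : ∀ x : (T : Set P), ∃ i, b i = x := fun x => by
      have := x.2; simpa [T] using this
    choose s hs using hS
    choose t ht using hT
    let e : (S : Set P) ≃o (T : Set P) :=
      { toFun := fun x => ⟨b (s x), by simp [T]⟩
        invFun := fun x => ⟨a (t x), by simp [S]⟩
        left_inv := fun x => by
          apply Subtype.ext
          change a _ = _
          rw [← hs x, hae, ht]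
        right_inv := fun x => by
          apply Subtype.ext
          change b _ = _
          rw [← ht x, ← hae, hs]
        map_rel_iff' := by
          intro x y
          change b _ ≤ b _ ↔ (x : P) ≤ y
          rw [← hab, hs, hs] }
    obtain ⟨g, hg⟩ := hH S T e
    refine ⟨g.toEquiv, hAut _ fun x y => g.le_iff_le, fun x y => g.le_iff_le, fun i => ?_⟩
    have hi : a i ∈ (S : Set P) := by simp [S]
    have h1 := hg ⟨a i, hi⟩
    change g (a i) = _
    rw [show g (a i) = _ from h1]
    change b _ = _
    rw [← hae, hs]
  refine ⟨hom, ?_⟩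
  intro Q κ _ _ _ e Z hZ
  have := Fintype.ofFinite Q
  obtain ⟨ψ⟩ := hU Q
  obtain ⟨h, -, hh, hk⟩ := hom (fun k => ψ (e k)) Z fun i j => by rw [hZ, ψ.le_iff_le]
  exact ⟨fun q => h (ψ q), fun p q => by rw [hh, ψ.le_iff_le], hk⟩

theorem Rich.dual {G : Subgroup (Equiv.Perm P)} (R : Rich G) : @Rich P (dualPO P) G := by
  refine @Rich.mk P (dualPO P) G ?_ ?_
  · intro ι _ a b hab
    obtain ⟨h, hG, ho, hi⟩ := R.hom a b fun i j => hab j i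
    exact ⟨h, hG, (isOrderAuto_dual h).2 ho, hi⟩
  · intro Q κ _ _ _ e Z hZ
    obtain ⟨φ, h1, h2⟩ := @Rich.ext P _ G R Q κ (dualPO Q) _ _ e Z fun i j => hZ j i
    exact ⟨φ, fun p q => h1 q p, h2⟩

theorem Rich.pt {G : Subgroup (Equiv.Perm P)} (R : Rich G) (F A B : Set P) [Finite F] [Finite A]
    [Finite B] (h : ∀ a ∈ A, ∀ b ∈ B, a < b) :
    ∃ x, ∀ p ∈ F, (p ≤ x ↔ ∃ a ∈ A, p ≤ a) ∧ (x ≤ p ↔ ∃ b ∈ B, b ≤ p) := by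
  let K : Set P := F ∪ (A ∪ B)
  let Q := Option K
  let le : Q → Q → Prop := fun p q => match p, q with
    | none, none => True
    | some p, some q => (p : P) ≤ q
    | some p, none => ∃ a ∈ A, (p : P) ≤ a
    | none, some q => ∃ b ∈ B, b ≤ (q : P)
  let po : PartialOrder Q :=
    { le := le
      lt := fun p q => le p q ∧ ¬ le q p
      lt_iff_le_not_ge := fun _ _ => Iff.rfl
      le_refl := by
        rintro (_ | p)
        · trivial
        · exact le_rfl
      le_trans := by
        rintro (_ | p) (_ | q) (_ | r) h1 h2
        · trivial
        · exact h2
        · trivial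
        · obtain ⟨b, hb, hb'⟩ := h1
          exact ⟨b, hb, hb'.trans h2⟩
        · exact h1
        · obtain ⟨b, hb, hb'⟩ := h2
          obtain ⟨a, ha, ha'⟩ := h1
          exact ha'.trans ((h a ha b hb).le.trans hb')
        · obtain ⟨a, ha, ha'⟩ := h2
          exact ⟨a, ha, le_trans h1 ha'⟩
        · exact le_trans (α := P) h1 h2
      le_antisymm := by
        rintro (_ | p) (_ | q) h1 h2
        · rfl
        · obtain ⟨b, hb, hb'⟩ := h1
          obtain ⟨a, ha, ha'⟩ := h2
          exact absurd ((h a ha b hb).trans_le (hb'.trans ha')) (lt_irrefl _)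
        · obtain ⟨b, hb, hb'⟩ := h2
          obtain ⟨a, ha, ha'⟩ := h1
          exact absurd ((h a ha b hb).trans_le (hb'.trans ha')) (lt_irrefl _)
        · exact congrArg some (Subtype.ext (le_antisymm h1 h2)) }
  obtain ⟨φ, h1, h2⟩ := R.ext (Q := Q) (κ := K) some (fun k => k.1) fun i j => Iff.rfl
  refine ⟨φ none, fun p hp => ?_⟩
  have hk := h2 ⟨p, Or.inl hp⟩
  have e1 := h1 (some ⟨p, Or.inl hp⟩) none
  have e2 := h1 none (some ⟨p, Or.inl hp⟩)
  rw [hk] at e1 e2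
  exact ⟨e1, e2⟩

theorem Rich.exists_perp {G : Subgroup (Equiv.Perm P)} (R : Rich G) (F : Set P) [Finite F] :
    ∃ x, ∀ p ∈ F, Perp p x := by
  obtain ⟨x, hx⟩ := R.pt F ∅ ∅ (by simp)
  refine ⟨x, fun p hp => ?_⟩
  have := hx p hp
  simp at this
  exact this

theorem Rich.lev {G : Subgroup (Equiv.Perm P)} (R : Rich G) {κ J : Type} [Finite κ] [Finite J]
    {Z : κ → P} (hZ : AC Z) (S : J → Set κ) :
    ∃ X : J → P, AC X ∧ (∀ k j, Z k ≤ X j ↔ k ∈ S j) ∧ ∀ k j, ¬ X j ≤ Z k := by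
  let Q := κ ⊕ J
  let po : PartialOrder Q :=
    { le := fun p q => match p, q with
        | .inl p, .inl q => p = q
        | .inr p, .inr q => p = q
        | .inl p, .inr q => p ∈ S q
        | .inr _, .inl _ => False
      le_refl := by rintro (p | p) <;> rfl
      le_trans := by
        rintro (p | p) (q | q) (r | r) h1 h2
        · exact h1.trans h2
        · exact h1 ▸ h2
        · exact h2.elim
        · exact h2 ▸ h1
        · exact h1.elim
        · exact h1.elim
        · exact h2.elim
        · exact h1.trans h2
      le_antisymm := by
        rintro (p | p) (q | q) h1 h2
        · exact congrArg _ h1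
        · exact h2.elim
        · exact h1.elim
        · exact congrArg _ h1 }
  obtain ⟨φ, h1, h2⟩ := R.ext (Q := Q) (κ := κ) Sum.inl Z fun _ _ => hZ.le_iff
  refine ⟨fun j => φ (.inr j), fun i j n => ⟨fun l => n ((h1 _ _).1 l), fun l => n ((h1 _ _).1 l).symm⟩,
    fun k j => ?_, fun k j l => ?_⟩
  · rw [← h2, h1]
    exact Iff.rfl
  · rw [← h2, h1] at l
    exact l

theorem Rich.exists_swap {G : Subgroup (Equiv.Perm P)} (R : Rich G) (F : Set P) [Finite F] {u v : P}
    (huv : Perp u v) (h : ∀ p ∈ F, (p ≤ u ↔ p ≤ v) ∧ (u ≤ p ↔ v ≤ p)) :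
    ∃ σ ∈ G, IsOrderAuto σ ∧ σ u = v ∧ σ v = u ∧ ∀ p ∈ F, σ p = p := by
  let a : Option (Option F) → P := fun o => match o with
    | none => u
    | some none => v
    | some (some p) => p
  let b : Option (Option F) → P := fun o => match o with
    | none => v
    | some none => u
    | some (some p) => p
  obtain ⟨σ, hG, ho, hi⟩ := R.hom a b (by
    rintro (_ | _ | i) (_ | _ | j)
    · exact ⟨fun _ => le_rfl, fun _ => le_rfl⟩
    · exact ⟨fun l => (huv.1 l).elim, fun l => (huv.2 l).elim⟩
    · exact (h _ j.2).2
    · exact ⟨fun l => (huv.2 l).elim, fun l => (huv.1 l).elim⟩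
    · exact ⟨fun _ => le_rfl, fun _ => le_rfl⟩
    · exact (h _ j.2).2.symm
    · exact (h _ i.2).1
    · exact (h _ i.2).1.symm
    · exact Iff.rfl)
  exact ⟨σ, hG, ho, hi none, hi (some none), fun p hp => hi (some (some ⟨p, hp⟩))⟩

/-- `G` can lower any point lying above part of a finite antichain to a point incomparable with
it, while fixing the antichain. -/
def DC (G : Subgroup (Equiv.Perm P)) : Prop :=
  ∀ (ι : Type) [Finite ι] (Y : ι → P) (x : P), AC Y → (∀ i, ¬ x ≤ Y i) →
    ∃ g ∈ G, (∀ i, g (Y i) = Y i) ∧ ∀ i, Perp (Y i) (g x)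

/-- For points lying above a large part of a finite antichain and not above another large part,
the members of `G` keeping the antichain preserve the induced bipartition of the antichain. -/
def ND (G : Subgroup (Equiv.Perm P)) (t : ℕ) : Prop :=
  ∀ (ι : Type) [Finite ι] (Y : ι → P) (x : P) (g : Equiv.Perm P) (A B : Fin t → ι), g ∈ G →
    AC Y → AC (fun i => g (Y i)) → (∀ i, ¬ x ≤ Y i) → A.Injective → B.Injective →
    (∀ k, ¬ Perp x (Y (A k))) → (∀ k, Perp x (Y (B k))) →
    ∀ i j, (Perp x (Y i) ↔ Perp x (Y j)) ↔ (Perp (g x) (g (Y i)) ↔ Perp (g x) (g (Y j)))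

theorem exists_avoiding {ι : Type} {n : ℕ} (A : Fin (n + 1) → ι) (hA : A.Injective) (i : ι) :
    ∃ A' : Fin n → ι, A'.Injective ∧ (∀ k, ∃ m, A' k = A m) ∧ ∀ k, A' k ≠ i := by
  by_cases h : ∃ m, A m = i
  · obtain ⟨m, rfl⟩ := h
    exact ⟨fun k => A (m.succAbove k), hA.comp Fin.succAbove_right_injective, fun k => ⟨_, rfl⟩,
      fun k e => Fin.succAbove_ne m k (hA e)⟩
  · push Not at h
    exact ⟨fun k => A k.castSucc, hA.comp (Fin.castSucc_injective n), fun k => ⟨_, rfl⟩,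
      fun k => h _⟩

theorem AC.perp_iff_lt {ι : Type} {Y : ι → P} {x : P} (hx : ∀ i, ¬ x ≤ Y i) (i : ι) :
    Perp x (Y i) ↔ ¬ Y i ≤ x := ⟨fun h => h.2, fun h => ⟨hx i, h⟩⟩

theorem AC.same_side {ι : Type} {Y : ι → P} (hY : AC Y) {x : P} (hx : ∀ i, x ≠ Y i) {i j : ι}
    (h : Perp x (Y i) ↔ Perp x (Y j)) : (x ≤ Y i ↔ x ≤ Y j) ∧ (Y i ≤ x ↔ Y j ≤ x) := by
  by_cases e : i = j
  · simp [e]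
  have h1 := hY i j e
  by_cases c : Perp x (Y i)
  · have d := h.1 c
    exact ⟨iff_of_false c.1 d.1, iff_of_false c.2 d.2⟩
  · have d := fun l => c (h.2 l)
    rcases lt_or_gt_of_not_perp c (hx i) with c | c <;>
      rcases lt_or_gt_of_not_perp d (hx j) with d | d
    · exact ⟨iff_of_true c.le d.le, iff_of_false c.not_ge d.not_ge⟩
    · exact (h1.2 (d.trans c).le).elim
    · exact (h1.1 (c.trans d).le).elim
    · exact ⟨iff_of_false c.not_ge d.not_ge, iff_of_true c.le d.le⟩

theorem not_nd_swap {G : Subgroup (Equiv.Perm P)} (R : Rich G) {n : ℕ} (h : ¬ ND G (n + 1)) :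
    ∃ (ι : Type) (_ : Finite ι) (Y : ι → P) (x : P) (A B : Fin n → ι) (i j : ι) (k : Equiv.Perm P),
      k ∈ G ∧ AC Y ∧ (∀ i, ¬ x ≤ Y i) ∧ A.Injective ∧ B.Injective ∧ (∀ k, Y (A k) ≤ x) ∧
      (∀ k, ¬ Y (B k) ≤ x) ∧ Y i ≤ x ∧ ¬ Y j ≤ x ∧ (∀ k, A k ≠ i) ∧ (∀ k, B k ≠ j) ∧
      k x = x ∧ k (Y i) = Y j ∧ ∀ l, l ≠ i → l ≠ j → k (Y l) = Y l := by
  unfold ND at h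
  push Not at h
  obtain ⟨ι, hι, Y, x, g, A, B, hg, hY, hgY, hx, hA, hB, hxA, hxB, i, j, hij⟩ := h
  have key : ∃ i j, ¬ Perp x (Y i) ∧ Perp x (Y j) ∧
      (Perp (g x) (g (Y i)) ↔ Perp (g x) (g (Y j))) := by
    have a0 := hxA 0
    have b0 := hxB 0
    generalize A 0 = a at *
    generalize B 0 = b at *
    grind
  obtain ⟨i, j, hi, hj, hs⟩ := key
  have hne : ∀ l, g x ≠ g (Y l) := fun l e => hx l (g.injective e).le
  have hijn : i ≠ j := fun e => hi (e ▸ hj)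
  obtain ⟨h1, h2⟩ := AC.same_side (Y := fun i => g (Y i)) hgY hne hs
  obtain ⟨σ, hσ, -, s1, s2, s3⟩ := R.exists_swap
    (insert (g x) (Set.range fun l : {l // l ≠ i ∧ l ≠ j} => g (Y l))) (hgY i j hijn) (by
      rintro p (rfl | ⟨⟨l, l1, l2⟩, rfl⟩)
      · exact ⟨h1, h2⟩
      · have e1 := hgY l i l1
        have e2 := hgY l j l2
        exact ⟨iff_of_false e1.1 e2.1, iff_of_false e1.2 e2.2⟩)
  obtain ⟨A', iA, rA, nA⟩ := exists_avoiding A hA i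
  obtain ⟨B', iB, rB, nB⟩ := exists_avoiding B hB j
  refine ⟨ι, hι, Y, x, A', B', i, j, g⁻¹ * σ * g, G.mul_mem (G.mul_mem (G.inv_mem hg) hσ) hg, hY,
    hx, iA, iB, fun k => ?_, fun k => ?_, ?_, ?_, nA, nB, ?_, ?_, fun l l1 l2 => ?_⟩
  · obtain ⟨m, hm⟩ := rA k
    have := hxA m
    rw [AC.perp_iff_lt hx, not_not] at this
    rwa [hm]
  · obtain ⟨m, hm⟩ := rB k
    rw [hm]
    exact (hxB m).2
  · rwa [AC.perp_iff_lt hx, not_not] at hi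
  · exact hj.2
  · simp [s3 (g x) (Or.inl rfl)]
  · simp [s1]
  · simp [s3 (g (Y l)) (Or.inr ⟨⟨l, l1, l2⟩, rfl⟩)]

theorem lower_one {G : Subgroup (Equiv.Perm P)} (R : Rich G) (h : ∀ t, ¬ ND G t) {ι : Type}
    [Finite ι] {Y : ι → P} {x : P} (hY : AC Y) (hx : ∀ i, ¬ x ≤ Y i) {i₀ : ι} (hi₀ : Y i₀ ≤ x) :
    ∃ g ∈ G, (∀ i, g (Y i) = Y i) ∧ (∀ i, ¬ g x ≤ Y i) ∧
      ∀ i, Y i ≤ g x ↔ Y i ≤ x ∧ i ≠ i₀ := by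
  classical
  obtain ⟨κ, hκ, Z, z, A, B, i, j, k, hk, hZ, hz, iA, iB, hA, hB, hi, hj, nA, nB, k1, k2, k3⟩ :=
    not_nd_swap R (h (Nat.card ι + 1))
  let e := Finite.equivFin ι
  let f : ι → κ := fun l => if l = i₀ then i else if Y l ≤ x then A (e l) else B (e l)
  have f0 : f i₀ = i := if_pos rfl
  have f1 : ∀ l, l ≠ i₀ → f l = if Y l ≤ x then A (e l) else B (e l) := fun l hl => if_neg hl
  have fz : ∀ l, Z (f l) ≤ z ↔ Y l ≤ x := by
    intro l
    by_cases hl : l = i₀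
    · rw [hl, f0]
      exact iff_of_true hi hi₀
    · rw [f1 l hl]
      split_ifs with c
      · exact iff_of_true (hA _) c
      · exact iff_of_false (hB _) c
  have fj : ∀ l, f l ≠ j := by
    intro l hl
    by_cases c : Y l ≤ x
    · exact hj (hl ▸ (fz l).2 c)
    · have : l ≠ i₀ := fun e => c (e ▸ hi₀)
      rw [f1 l this, if_neg c] at hl
      exact nB _ hl
  have fi : ∀ l, f l = i → l = i₀ := by
    intro l hl
    by_contra n
    have c : Y l ≤ x := (fz l).1 (hl ▸ hi)
    rw [f1 l n, if_pos c] at hl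
    exact nA _ hl
  have finj : f.Injective := by
    intro l m hlm
    by_cases hl : l = i₀
    · rw [hl, f0] at hlm
      rw [hl, fi m hlm.symm]
    have hm : m ≠ i₀ := fun e => hl (fi l (by rw [hlm, e, f0]))
    have c : Y l ≤ x ↔ Y m ≤ x := by rw [← fz, ← fz, hlm]
    rw [f1 l hl, f1 m hm] at hlm
    by_cases d : Y l ≤ x
    · rw [if_pos d, if_pos (c.1 d)] at hlm
      exact e.injective (iA hlm)
    · rw [if_neg d, if_neg (fun q => d (c.2 q))] at hlm
      exact e.injective (iB hlm)
  have hZf : AC (fun l => Z (f l)) := hZ.comp finj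
  obtain ⟨u, hu, -, hu'⟩ := R.hom (ι := Option ι) (fun o => o.elim x Y)
    (fun o => o.elim z fun l => Z (f l)) (by
      rintro (_ | l) (_ | m)
      · exact iff_of_true le_rfl le_rfl
      · exact iff_of_false (hx _) (hz _)
      · exact (fz l).symm
      · exact hY.le_iff.trans hZf.le_iff.symm)
  let f' : ι → κ := fun l => if l = i₀ then j else f l
  have finj' : f'.Injective := by
    intro l m hlm
    simp only [f'] at hlm
    split_ifs at hlm with c d d
    · rw [c, d]
    · exact (fj _ hlm.symm).elim
    · exact (fj _ hlm).elim
    · exact finj hlm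
  have hZf' : AC (fun l => Z (f' l)) := hZ.comp finj'
  obtain ⟨v, hv, vo, hv'⟩ := R.hom (fun l => Z (f' l)) Y fun l m => hZf'.le_iff.trans hY.le_iff.symm
  have hux : u x = z := hu' none
  have huY : ∀ l, u (Y l) = Z (f l) := fun l => hu' (some l)
  have hkf : ∀ l, k (Z (f l)) = Z (f' l) := by
    intro l
    by_cases hl : l = i₀
    · simp [f', hl, f0, k2]
    · simp only [f', if_neg hl]
      exact k3 _ (fun c => hl (fi l c)) (fj l)
  refine ⟨v * k * u, G.mul_mem (G.mul_mem hv hk) hu, fun l => ?_, fun l => ?_, fun l => ?_⟩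
  · simp [huY, hkf, hv']
  · rw [← hv' l]
    simp only [Equiv.Perm.coe_mul, Function.comp_apply, hux, k1, vo _ _]
    exact hz _
  · rw [← hv' l]
    simp only [Equiv.Perm.coe_mul, Function.comp_apply, hux, k1, vo _ _]
    rw [hv' l]
    by_cases hl : l = i₀
    · simp [f', hl, hj]
    · simp [f', hl, fz]

theorem dc_of_not_nd {G : Subgroup (Equiv.Perm P)} (R : Rich G) (h : ∀ t, ¬ ND G t) : DC G := by
  intro ι _ Y x hY hx
  induction hn : {i | Y i ≤ x}.ncard using Nat.strong_induction_on generalizing x with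
  | _ n ih =>
    by_cases c : ∃ i₀, Y i₀ ≤ x
    · obtain ⟨i₀, hi₀⟩ := c
      obtain ⟨g, hg, g1, g2, g3⟩ := lower_one R h hY hx hi₀
      have lt : {i | Y i ≤ g x}.ncard < n := by
        rw [← hn]
        refine Set.ncard_lt_ncard (Set.ssubset_iff_exists.2 ⟨fun i hi => ((g3 i).1 hi).1, i₀, hi₀, ?_⟩)
        exact fun hi => ((g3 i₀).1 hi).2 rfl
      obtain ⟨k, hk, k1, k2⟩ := ih _ lt (g x) g2 rfl
      exact ⟨k * g, G.mul_mem hk hg, fun i => by simp [g1, k1], fun i => by simpa using k2 i⟩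
    · push Not at c
      exact ⟨1, G.one_mem, fun i => rfl, fun i => ⟨c i, hx i⟩⟩

theorem ND.mono {G : Subgroup (Equiv.Perm P)} {s t : ℕ} (h : ND G s) (hst : s ≤ t) : ND G t := by
  intro ι _ Y x g A B hg hY hgY hx hA hB hxA hxB
  exact h ι Y x g (A ∘ Fin.castLE hst) (B ∘ Fin.castLE hst) hg hY hgY hx
    (hA.comp (Fin.castLE_injective hst)) (hB.comp (Fin.castLE_injective hst))
    (fun k => hxA _) (fun k => hxB _)

theorem Rich.above {G : Subgroup (Equiv.Perm P)} (R : Rich G) {ι : Type} [Finite ι] {Y : ι → P}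
    (hY : AC Y) (S : Set ι) : ∃ x, (∀ i, ¬ x ≤ Y i) ∧ ∀ i, Perp x (Y i) ↔ i ∉ S := by
  obtain ⟨X, -, h1, h2⟩ := R.lev (J := Unit) hY fun _ => S
  refine ⟨X (), fun i => h2 i (), fun i => ?_⟩
  rw [AC.perp_iff_lt fun i => h2 i (), h1]

theorem exists_cut (p : ℕ → Prop) (hp : ∀ i j, i ≤ j → p j → p i) (n : ℕ) :
    ∃ a : Fin (n + 1), ∀ i < n, p i ↔ i < a := by
  classical
  have hex : ∃ i, n ≤ i ∨ ¬ p i := ⟨n, Or.inl le_rfl⟩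
  have hle : Nat.find hex ≤ n := Nat.find_min' hex (Or.inl le_rfl)
  refine ⟨⟨Nat.find hex, by omega⟩, fun i hi => ⟨fun h => ?_, fun h => ?_⟩⟩
  · by_contra c
    change ¬ i < Nat.find hex at c
    rcases Nat.find_spec hex with d | d
    · omega
    · exact d (hp _ _ (by omega) h)
  · have := Nat.find_min hex h
    push Not at this
    exact this.2

theorem exists_sq_lt_two_pow (m : ℕ) : ∃ k, (m + k + 1) * (m + k + 1) < 2 ^ k := by
  refine ⟨(m + 4) + (m + 4), ?_⟩
  rw [pow_add]
  have h : m + (m + 4 + (m + 4)) + 1 < 2 ^ (m + 4) := by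
    have := @Nat.lt_two_pow_self m
    rw [pow_add]
    omega
  exact Nat.mul_lt_mul'' h h

theorem ND.not_strictMono {G : Subgroup (Equiv.Perm P)} (R : Rich G) {t : ℕ} (h : ND G t)
    (ht : 0 < t) {Y : ℕ → P} (hY : AC Y) {g : Equiv.Perm P} (hg : g ∈ G) :
    ¬ StrictMono fun i => g (Y i) := by
  intro hm
  obtain ⟨k, hk⟩ := exists_sq_lt_two_pow (2 * t)
  set n := 2 * t + k with hn
  have hY' : AC fun i : Fin n => Y i := hY.comp Fin.val_injective
  obtain ⟨X, -, hX, hX'⟩ := R.lev hY' fun f : Fin k → Bool =>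
    {i | i.1 < t ∨ ∃ m : Fin k, i.1 = 2 * t + m ∧ f m = true}
  have hne : ∀ f (i : Fin n), g (X f) ≠ g (Y i) := fun f i e => hX' i f (g.injective e).le
  choose a ha using fun f => exists_cut (fun i => g (Y i) ≤ g (X f))
    (fun i j hij l => (hm.monotone hij).trans l) n
  choose b hb using fun f => exists_cut (fun i => ¬ g (X f) ≤ g (Y i))
    (fun i j hij l l' => l (l'.trans (hm.monotone hij))) n
  obtain ⟨f, f', hff, hcode⟩ := Fintype.exists_ne_map_eq_of_card_lt (fun f => (a f, b f)) (by simpa)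
  rw [Prod.mk.injEq] at hcode
  obtain ⟨σ, hσ, -, hs⟩ := R.hom (ι := Option (Fin n)) (fun o => o.elim (g (X f)) fun i => g (Y i))
    (fun o => o.elim (g (X f')) fun i => g (Y i)) (by
      rintro (_ | i) (_ | j)
      · exact iff_of_true le_rfl le_rfl
      · change g (X f) ≤ g (Y j) ↔ g (X f') ≤ g (Y j)
        rw [← not_iff_not, hb f j j.2, hb f' j j.2, hcode.2]
      · change g (Y i) ≤ g (X f) ↔ g (Y i) ≤ g (X f')
        rw [ha f i i.2, ha f' i i.2, hcode.1]
      · exact Iff.rfl)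
  have s0 : σ (g (X f)) = g (X f') := hs none
  have s1 : ∀ i : Fin n, σ (g (Y i)) = g (Y i) := fun i => hs (some i)
  obtain ⟨m, hmf⟩ : ∃ m, f m ≠ f' m := by
    by_contra! c
    exact hff (funext c)
  have key := h _ (fun i : Fin n => Y i) (X f) (g⁻¹ * σ * g) (fun k => ⟨k, by omega⟩)
    (fun k => ⟨t + k, by omega⟩) (G.mul_mem (G.mul_mem (G.inv_mem hg) hσ) hg) hY'
    (by simpa [s1] using hY') (fun i => hX' i f) (fun a b e => by ext; simpa using e)
    (fun a b e => by ext; simpa using e)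
    (fun i hi => hi.2 ((hX _ _).2 (Or.inl i.2)))
    (fun i => ⟨hX' _ _, fun l => by
      rcases (hX _ _).1 l with c | ⟨m, c, -⟩
      · simp at c
      · simp only at c
        omega⟩) ⟨0, by omega⟩ ⟨2 * t + m, by omega⟩
  have hP : ∀ f (i : Fin n), Perp (X f) (Y i) ↔
      ¬ (i.1 < t ∨ ∃ m : Fin k, i.1 = 2 * t + m ∧ f m = true) := fun f i => by
    rw [AC.perp_iff_lt (Y := fun i : Fin n => Y i) fun i => hX' i f, hX]
    rfl
  have e0 : ∀ f, ¬ Perp (X f) (Y (⟨0, by omega⟩ : Fin n)) := fun f => by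
    rw [hP, not_not]
    exact Or.inl ht
  have e1 : ∀ f, Perp (X f) (Y (⟨2 * t + m, by omega⟩ : Fin n)) ↔ ¬ f m = true := fun f => by
    rw [hP]
    refine not_congr ⟨?_, fun c => Or.inr ⟨m, rfl, c⟩⟩
    rintro (c | ⟨m', c, d⟩)
    · simp only at c
      omega
    · have : m' = m := by
        ext
        simp only at c
        omega
      exact this ▸ d
  have s2 := s1 ⟨0, by omega⟩
  have s3 := s1 ⟨2 * t + m, by omega⟩
  simp only at s2 s3
  simp only [Equiv.Perm.coe_mul, Function.comp_apply, s0, s2, s3, Equiv.Perm.inv_def,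
    Equiv.symm_apply_apply] at key
  have e2 := e0 f
  have e3 := e0 f'
  have e4 := e1 f
  have e5 := e1 f'
  simp only at e2 e3 e4 e5
  have e6 : f m = true ↔ ¬ f' m = true := by
    rcases Bool.eq_false_or_eq_true (f m) with c | c <;>
      rcases Bool.eq_false_or_eq_true (f' m) with d | d <;> simp_all
  tauto

/-- An even number of the three pairs are comparable. -/
def Ev (a b c : P) : Prop := Perp a b ↔ (Perp b c ↔ Perp a c)

theorem ND.ev_of_blocks {G : Subgroup (Equiv.Perm P)} (R : Rich G) {t : ℕ} (h : ND G t)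
    (ht : 0 < t) {B : Fin 3 → Fin t × Bool → P} (hB : AC fun s : Fin 3 × Fin t × Bool => B s.1 s.2)
    {g : Equiv.Perm P} (hg : g ∈ G) (hgB : ∀ k, AC fun s => g (B k s))
    (hom : ∀ k l, k ≠ l → (∀ s s', g (B k s) < g (B l s')) ∨ (∀ s s', g (B l s') < g (B k s)) ∨
      ∀ s s', Perp (g (B k s)) (g (B l s'))) (s₀ s₁ s₂ : Fin t × Bool) :
    Ev (g (B 0 s₀)) (g (B 1 s₁)) (g (B 2 s₂)) := by
  obtain ⟨x, hx, hxS⟩ := R.above hB {s | s.2.2 = true}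
  have hpq : ∀ k, ∃ p q, ¬ Perp (g x) (g (B k p)) ∧ Perp (g x) (g (B k q)) := by
    intro k
    have h1 : ∀ s, Perp x (B k s) ↔ s.2 ≠ true := fun s => hxS (k, s)
    have := h (Fin t × Bool) (B k) x g (fun m => (m, true)) (fun m => (m, false)) hg
      (hB.comp (f := fun s => (k, s)) fun a b e => by simpa using e) (hgB k) (fun i => hx (k, i))
      (fun a b e => by simpa using e) (fun a b e => by simpa using e) (fun m => by simp [h1])
      (fun m => by simp [h1]) (⟨0, ht⟩, true) (⟨0, ht⟩, false)
    simp only [h1] at this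
    by_cases c : Perp (g x) (g (B k (⟨0, ht⟩, true)))
    · exact ⟨(⟨0, ht⟩, false), (⟨0, ht⟩, true), by simp_all, c⟩
    · exact ⟨(⟨0, ht⟩, true), (⟨0, ht⟩, false), c, by simp_all⟩
  choose p q hp hq using hpq
  have hne : ∀ k s, g x ≠ g (B k s) := fun k s e => hx (k, s) (g.injective e).le
  have hlt : ∀ k l, (∀ s s', g (B k s) < g (B l s')) → g (B k (p k)) < g x ∧ g x < g (B l (p l)) := by
    intro k l hkl
    constructor
    · rcases lt_or_gt_of_not_perp (hp k) (hne _ _) with c | c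
      · exact ((hq l).not_lt (c.trans (hkl _ _))).elim
      · exact c
    · rcases lt_or_gt_of_not_perp (hp l) (hne _ _) with c | c
      · exact c
      · exact ((hq k).symm.not_lt ((hkl _ _).trans c)).elim
  have main : ∀ k l, k ≠ l → ∀ s s', Perp (g (B k s)) (g (B l s')) ↔
      (g (B k (p k)) < g x ↔ g (B l (p l)) < g x) := by
    intro k l hkl s s'
    rcases hom k l hkl with c | c | c
    · obtain ⟨h1, h2⟩ := hlt k l c
      exact iff_of_false (not_perp_of_lt (c _ _)) fun h => (h.1 h1).asymm h2
    · obtain ⟨h1, h2⟩ := hlt l k fun s s' => c s' s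
      exact iff_of_false (not_perp_of_gt (c _ _)) fun h => (h.2 h1).asymm h2
    · refine iff_of_true (c _ _) ⟨fun h1 => ?_, fun h1 => ?_⟩
      · rcases lt_or_gt_of_not_perp (hp l) (hne _ _) with d | d
        · exact ((c _ _).not_lt (h1.trans d)).elim
        · exact d
      · rcases lt_or_gt_of_not_perp (hp k) (hne _ _) with d | d
        · exact ((c _ _).symm.not_lt (h1.trans d)).elim
        · exact d
  unfold Ev
  rw [main 0 1 (by decide), main 1 2 (by decide), main 0 2 (by decide)]
  tauto

/-- The dual of `DC`. -/
def UC (G : Subgroup (Equiv.Perm P)) : Prop :=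
  ∀ (ι : Type) [Finite ι] (Y : ι → P) (x : P), AC Y → (∀ i, ¬ Y i ≤ x) →
    ∃ g ∈ G, (∀ i, g (Y i) = Y i) ∧ ∀ i, Perp (Y i) (g x)

theorem dc_dual (G : Subgroup (Equiv.Perm P)) : @DC P (dualPO P) G ↔ UC G := by
  simp only [DC, UC, ac_dual, perp_dual]
  exact Iff.rfl

theorem uc_dual (G : Subgroup (Equiv.Perm P)) : @UC P (dualPO P) G ↔ DC G := by
  simp only [DC, UC, ac_dual, perp_dual]
  exact Iff.rfl

theorem Rich.exists_ac_nat {G : Subgroup (Equiv.Perm P)} (R : Rich G) (F : Set P) [Finite F] :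
    ∃ Y : ℕ → P, AC Y ∧ ∀ k, ∀ p ∈ F, Perp p (Y k) := by
  obtain ⟨Y, h1, h2⟩ := exists_seq_of_forall_finset_exists (fun y => ∀ p ∈ F, Perp p y) Perp
    fun s _ => by
      obtain ⟨y, hy⟩ := R.exists_perp (F ∪ s)
      exact ⟨y, fun p hp => hy p (Or.inl hp), fun p hp => hy p (Or.inr hp)⟩
  refine ⟨Y, fun i j n => ?_, h1⟩
  rcases lt_or_gt_of_ne n with c | c
  · exact h2 i j c
  · exact (h2 j i c).symm

theorem Rich.exists_ac {G : Subgroup (Equiv.Perm P)} (R : Rich G) (F : Set P) [Finite F]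
    (κ : Type) [Finite κ] : ∃ Y : κ → P, AC Y ∧ ∀ k, ∀ p ∈ F, Perp p (Y k) := by
  obtain ⟨Y, h1, h2⟩ := R.exists_ac_nat F
  exact ⟨fun k => Y (Finite.equivFin κ k), h1.comp (f := fun k => (Finite.equivFin κ k).1)
    (Fin.val_injective.comp (Finite.equivFin κ).injective), fun k => h2 _⟩

/-- Index type of a block of `2 * t` points. -/
abbrev Blk (t : ℕ) : Type := Fin t × Bool

/-- Index type of two blocks. -/
abbrev Side (t : ℕ) : Type := Blk t ⊕ Blk t

/-- Index type of an antichain over which two blocks of points in general position lie. -/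
abbrev Code (t : ℕ) : Type := (Side t → Bool) × Blk t

theorem iff_of_transfer {a b y a' b' y' : Prop} (h₁ : (a ↔ y) ↔ (a' ↔ y'))
    (h₂ : (b ↔ y) ↔ (b' ↔ y')) (h : ¬ (a' ∧ ¬ b')) (hab : b ↔ ¬ a) : y' ↔ (y ↔ b) := by
  by_cases a <;> by_cases b <;> by_cases y <;> by_cases a' <;> by_cases b' <;> by_cases y' <;>
    simp_all

theorem ND.false_of_uc {G : Subgroup (Equiv.Perm P)} (R : Rich G) {t : ℕ} (h : ND G t)
    (ht : 0 < t) (hU : UC G) : False := by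
  -- the configuration `a' < b` together with an antichain `Y` incomparable with both
  obtain ⟨b, -⟩ := R.exists_perp ∅
  obtain ⟨a', ha'⟩ := R.pt {b} ∅ {b} (by simp)
  have hab : a' < b := by
    have := ha' b rfl
    simp at this
    exact lt_of_le_not_ge this.2 this.1
  obtain ⟨Y, hY, hYu⟩ := R.exists_ac {a', b} (Code t)
  have hYa : ∀ k, Perp a' (Y k) := fun k => hYu k a' (by simp)
  have hYb : ∀ k, Perp b (Y k) := fun k => hYu k b (by simp)
  have hbY : AC fun o : Option (Code t) => o.elim b Y := by
    rintro (_ | k) (_ | l) n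
    · exact (n rfl).elim
    · exact hYb l
    · exact (hYb k).symm
    · exact hY k l (by simpa using n)
  have haY : AC fun o : Option (Code t) => o.elim a' Y := by
    rintro (_ | k) (_ | l) n
    · exact (n rfl).elim
    · exact hYa l
    · exact (hYa k).symm
    · exact hY k l (by simpa using n)
  obtain ⟨f₀, hf₀, f1, f2⟩ := hU _ _ a' hbY (by
    rintro (_ | k)
    · exact hab.not_ge
    · exact (hYa k).2)
  obtain ⟨A, f, hf, hfA, hfb, hfY, hAb, hAY⟩ : ∃ A, ∃ f ∈ G, f A = a' ∧ f b = b ∧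
      (∀ k, f (Y k) = Y k) ∧ Perp A b ∧ ∀ k, Perp A (Y k) :=
    ⟨f₀ a', f₀⁻¹, G.inv_mem hf₀, by simp, Equiv.Perm.inv_eq_iff_eq.2 (f1 none).symm,
      fun k => Equiv.Perm.inv_eq_iff_eq.2 (f1 (some k)).symm, (f2 none).symm,
      fun k => (f2 (some k)).symm⟩
  clear hYu f1 f2 hf₀ f₀
  have hZ : AC fun o : Option (Option (Code t)) => o.elim A fun o => o.elim b Y := by
    rintro (_ | k) (_ | l) n
    · exact (n rfl).elim
    · cases l
      · exact hAb
      · exact hAY _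
    · cases k
      · exact hAb.symm
      · exact (hAY _).symm
    · exact hbY k l (by simpa using n)
  have hAY' : AC fun o : Option (Code t) => o.elim A Y := by
    rintro (_ | k) (_ | l) n
    · exact (n rfl).elim
    · exact hAY l
    · exact (hAY k).symm
    · exact hY k l (by simpa using n)
  obtain ⟨X, hX, hXS, hXD⟩ := R.lev hZ fun j : Side t => {o | o.elim (j.isLeft = true) fun o =>
    o.elim (j.isRight = true) fun k => k.1 j = true}
  have hA : ∀ j, Perp (X j) A ↔ ¬ j.isLeft = true := fun j => by
    have := hXS none j
    exact ⟨fun h l => h.2 (this.2 l), fun l => ⟨hXD none j, fun c => l (this.1 c)⟩⟩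
  have hb : ∀ j, Perp (X j) b ↔ ¬ j.isRight = true := fun j => by
    have := hXS (some none) j
    exact ⟨fun h l => h.2 (this.2 l), fun l => ⟨hXD (some none) j, fun c => l (this.1 c)⟩⟩
  have hk : ∀ j k, Perp (X j) (Y k) ↔ ¬ k.1 j = true := fun j k => by
    have := hXS (some (some k)) j
    exact ⟨fun h l => h.2 (this.2 l), fun l => ⟨hXD (some (some k)) j, fun c => l (this.1 c)⟩⟩
  have hDY : ∀ j k, ¬ X j ≤ Y k := fun j k => hXD (some (some k)) j
  have hDb : ∀ j, ¬ X j ≤ b := fun j => hXD (some none) j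
  have hDA : ∀ j, ¬ X j ≤ A := fun j => hXD none j
  let φ₁ : Side t → Bool := fun _ => true
  let φ₀ : Side t → Bool := fun _ => false
  have i1 : ∀ φ : Side t → Bool, Function.Injective fun m : Fin t => ((φ, (m, true)) : Code t) := by
    intro φ a b e
    simpa using e
  have i2 : ∀ φ : Side t → Bool, Function.Injective fun m : Fin t => some ((φ, (m, true)) : Code t) := by
    intro φ a b e
    simpa using e
  -- `f (X j)` does not lie below a member of `Y`
  have hfD : ∀ j k, ¬ f (X j) ≤ Y k := by
    intro j k hk'
    have hne : f (X j) ≠ Y k := fun e => by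
      rw [← hfY k] at e
      exact hDY j k (f.injective e).le
    obtain ⟨g, hg, g1, g2⟩ := hU _ Y (f (X j)) hY (fun i l => by
      have := hY.le_iff.1 (l.trans hk')
      subst this
      exact hne (hk'.antisymm l))
    have := h (Code t) Y (X j) (g * f) (fun m => (φ₁, (m, true))) (fun m => (φ₀, (m, true)))
      (G.mul_mem hg hf) hY (by simpa [hfY, g1] using hY) (hDY j) (i1 _) (i1 _) (by simp [hk, φ₁])
      (by simp [hk, φ₀]) (φ₁, (⟨0, ht⟩, true)) (φ₀, (⟨0, ht⟩, true))
    simp [hk, hfY, g1, (g2 _).symm, φ₀, φ₁] at this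
  have kA : ∀ j k, (Perp (X j) A ↔ Perp (X j) (Y k)) ↔ (Perp (f (X j)) a' ↔ Perp (f (X j)) (Y k)) := by
    intro j k
    have := h (Option (Code t)) _ (X j) f (fun m => some (φ₁, (m, true))) (fun m => some (φ₀, (m, true)))
      hf hAY' (by convert haY using 2 with o; cases o <;> simp [hfA, hfY])
      (by rintro (_ | k); exacts [hDA j, hDY j k]) (i2 _) (i2 _) (by simp [hk, φ₁])
      (by simp [hk, φ₀]) none (some k)
    simpa [hfA, hfY] using this
  have kb : ∀ j k, (Perp (X j) b ↔ Perp (X j) (Y k)) ↔ (Perp (f (X j)) b ↔ Perp (f (X j)) (Y k)) := by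
    intro j k
    have := h (Option (Code t)) _ (X j) f (fun m => some (φ₁, (m, true))) (fun m => some (φ₀, (m, true)))
      hf hbY (by convert hbY using 2 with o; cases o <;> simp [hfb, hfY])
      (by rintro (_ | k); exacts [hDb j, hDY j k]) (i2 _) (i2 _) (by simp [hk, φ₁])
      (by simp [hk, φ₀]) none (some k)
    simpa [hfb, hfY] using this
  -- it is not incomparable with `a'` while comparable with `b`
  have hex : ∀ j, ¬ (Perp (f (X j)) a' ∧ ¬ Perp (f (X j)) b) := by
    rintro j ⟨c1, c2⟩
    have hne : f (X j) ≠ b := fun e => by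
      rw [← hfb] at e
      exact hDb j (f.injective e).le
    rcases lt_or_gt_of_not_perp c2 hne with d | d
    · obtain ⟨k, hk'⟩ : ∃ k, Y k ≤ f (X j) := by
        by_contra! c
        have h0 := hk j (φ₀, (⟨0, ht⟩, true))
        have h1 := hk j (φ₁, (⟨0, ht⟩, true))
        have h2 := kA j (φ₀, (⟨0, ht⟩, true))
        have h3 := kA j (φ₁, (⟨0, ht⟩, true))
        have h4 : ∀ k, Perp (f (X j)) (Y k) := fun k => ⟨hfD j k, c k⟩
        have h5 : Perp (X j) (Y (φ₀, ⟨0, ht⟩, true)) := by simp [h0, φ₀]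
        have h6 : ¬ Perp (X j) (Y (φ₁, ⟨0, ht⟩, true)) := by simp [h1, φ₁]
        simp only [h4, h5, h6, c1, iff_true, iff_false] at h2 h3
        exact h3 h2
      exact (hYb k).2 (hk'.trans d.le)
    · exact not_perp_of_gt (hab.trans d) c1
  have hleft : ∀ j k, Perp (f (X (.inl j))) (Y k) ↔ ¬ k.1 (.inl j) = true := by
    intro j k
    rw [iff_of_transfer (kA (.inl j) k) (kb (.inl j) k) (hex (.inl j)) (by simp [hA, hb]), hk, hb]
    simp
  have hright : ∀ j k, Perp (f (X (.inr j))) (Y k) ↔ k.1 (.inr j) = true := by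
    intro j k
    rw [iff_of_transfer (kA (.inr j) k) (kb (.inr j) k) (hex (.inr j)) (by simp [hA, hb]), hk, hb]
    simp
  have hle : ∀ j j' k, f (X j) ≤ f (X j') → Perp (f (X j')) (Y k) → Perp (f (X j)) (Y k) :=
    fun j j' k l hp => ⟨hfD _ _, fun c => hp.2 (c.trans l)⟩
  classical
  have hfX : AC fun j => f (X j) := by
    have : ∀ i j, i ≠ j → ¬ f (X i) ≤ f (X j) := by
      intro i j n l
      rcases i with i | i <;> rcases j with j | j
      · have := hle _ _ (fun k => decide (k = .inl i), (⟨0, ht⟩, true)) l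
        rw [hleft, hleft] at this
        simp at this n
        exact n this.symm
      · have := hle _ _ (fun k => true, (⟨0, ht⟩, true)) l
        rw [hleft, hright] at this
        simp at this
      · have := hle _ _ (fun k => false, (⟨0, ht⟩, true)) l
        rw [hleft, hright] at this
        simp at this
      · have := hle _ _ (fun k => decide (k = .inr j), (⟨0, ht⟩, true)) l
        rw [hright, hright] at this
        simp at this n
        exact n this
    exact fun i j n => ⟨this i j n, this j i n.symm⟩
  let B : Fin 3 → Blk t → P := ![fun s => Y (φ₀, s), fun s => X (.inl s), fun s => X (.inr s)]
  have hYX : ∀ j s, Perp (X j) (Y (φ₀, s)) := fun j s => by simp [hk, φ₀]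
  have hYl : ∀ j s, Perp (f (X (.inl j))) (Y (φ₀, s)) := fun j s => by simp [hleft, φ₀]
  have hYr : ∀ j s, Y (φ₀, s) < f (X (.inr j)) := fun j s => by
    have h1 : ¬ Perp (f (X (.inr j))) (Y (φ₀, s)) := by simp [hright, φ₀]
    have h2 := hfD (.inr j) (φ₀, s)
    rw [Perp, not_and_not_right] at h1
    exact lt_of_le_not_ge (h1 h2) h2
  have hlr : ∀ i j, Perp (f (X (.inl i))) (f (X (.inr j))) := fun i j => hfX _ _ (by simp)
  have ev := h.ev_of_blocks R ht (B := B) (g := f) (by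
      rintro ⟨k, s⟩ ⟨l, s'⟩ n
      fin_cases k <;> fin_cases l
      · exact hY _ _ (by simpa using n)
      · exact (hYX _ _).symm
      · exact (hYX _ _).symm
      · exact hYX _ _
      · exact hX _ _ (by simpa using n)
      · exact hX _ _ (by simp)
      · exact hYX _ _
      · exact hX _ _ (by simp)
      · exact hX _ _ (by simpa using n)) hf (by
      intro k s s' n
      fin_cases k
      · simpa [B, hfY] using hY _ _ (by simpa using n)
      · exact hfX _ _ (by simpa using n)
      · exact hfX _ _ (by simpa using n)) (by
      intro k l n
      fin_cases k <;> fin_cases l <;> simp [B, hfY, -Prod.forall] at n ⊢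
      · exact Or.inr (Or.inr fun a b => (hYl _ _).symm)
      · exact Or.inl fun a b => hYr _ _
      · exact Or.inr (Or.inr fun a b => hYl _ _)
      · exact Or.inr (Or.inr fun a b => hlr _ _)
      · exact Or.inr (Or.inl fun a b => hYr _ _)
      · exact Or.inr (Or.inr fun a b => (hlr _ _).symm)) (⟨0, ht⟩, true) (⟨0, ht⟩, true)
      (⟨0, ht⟩, true)
  have e1 := hYl (⟨0, ht⟩, true) (⟨0, ht⟩, true)
  have e2 := not_perp_of_lt (hYr (⟨0, ht⟩, true) (⟨0, ht⟩, true))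
  have e3 := hlr (⟨0, ht⟩, true) (⟨0, ht⟩, true)
  simp [Ev, B, hfY, e1.symm, e2, e3] at ev

theorem dc_of_uc {G : Subgroup (Equiv.Perm P)} (R : Rich G) (hU : UC G) : DC G := by
  refine dc_of_not_nd R fun t h => ?_
  exact (h.mono (Nat.le_succ t)).false_of_uc R t.succ_pos hU

theorem uc_of_dc {G : Subgroup (Equiv.Perm P)} (R : Rich G) (hD : DC G) : UC G :=
  (dc_dual G).1 (@dc_of_uc P (dualPO P) G R.dual ((uc_dual G).2 hD))

theorem exists_ac_of_dc_of_uc {G : Subgroup (Equiv.Perm P)} (hD : DC G) (hU : UC G) :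
    ∀ (n : ℕ) (a : Fin n → P), a.Injective → ∃ g ∈ G, AC fun i => g (a i) := by
  intro n
  induction n with
  | zero => exact fun a _ => ⟨1, G.one_mem, fun i => i.elim0⟩
  | succ n ih =>
    intro a ha
    obtain ⟨g, hg, hga⟩ := ih (fun i => a i.castSucc) (ha.comp (Fin.castSucc_injective n))
    have hne : ∀ i : Fin n, g (a (Fin.last n)) ≠ g (a i.castSucc) := fun i e =>
      (Fin.castSucc_lt_last i).ne' (ha (g.injective e))
    obtain ⟨k, hk, k1, k2⟩ : ∃ k ∈ G, (∀ i : Fin n, k (g (a i.castSucc)) = g (a i.castSucc)) ∧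
        ∀ i : Fin n, Perp (g (a i.castSucc)) (k (g (a (Fin.last n)))) := by
      by_cases c : ∃ i : Fin n, g (a (Fin.last n)) ≤ g (a i.castSucc)
      · obtain ⟨i, hi⟩ := c
        refine hU _ _ _ hga fun j l => ?_
        have := hga.le_iff.1 (l.trans hi)
        subst this
        exact hne _ (hi.antisymm l)
      · push Not at c
        exact hD _ _ _ hga c
    refine ⟨k * g, G.mul_mem hk hg, ?_⟩
    intro i j n
    induction i using Fin.lastCases with
    | last =>
      induction j using Fin.lastCases with
      | last => exact (n rfl).elim
      | cast j => simpa [k1] using (k2 j).symm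
    | cast i =>
      induction j using Fin.lastCases with
      | last => simpa [k1] using k2 i
      | cast j => simpa [k1] using hga i j (by simpa using n)

theorem eq_top_of_dc_of_uc {G : Subgroup (Equiv.Perm P)} (R : Rich G) (hG : IsClosedSubgroup G)
    (hD : DC G) (hU : UC G) : G = ⊤ := by
  refine (eq_top_iff).2 fun f _ => hG f fun S => ?_
  let a : Fin S.card → P := fun i => S.equivFin.symm i
  have ha : a.Injective := Subtype.val_injective.comp S.equivFin.symm.injective
  obtain ⟨g, hg, hga⟩ := exists_ac_of_dc_of_uc hD hU _ a ha
  obtain ⟨k, hk, hka⟩ := exists_ac_of_dc_of_uc hD hU _ (fun i => f (a i)) (f.injective.comp ha)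
  obtain ⟨h, hh, -, h1⟩ := R.hom (fun i => g (a i)) (fun i => k (f (a i))) fun i j => hga.le_iff.trans hka.le_iff.symm
  refine ⟨k⁻¹ * h * g, G.mul_mem (G.mul_mem (G.inv_mem hk) hh) hg, fun x hx => ?_⟩
  have : x = a (S.equivFin ⟨x, hx⟩) := by simp [a]
  rw [this]
  simp [h1]

/-- The dual of `ND`. -/
def NU (G : Subgroup (Equiv.Perm P)) (t : ℕ) : Prop := @ND P (dualPO P) G t

theorem eq_top_or_nd_nu {G : Subgroup (Equiv.Perm P)} (R : Rich G) (hG : IsClosedSubgroup G) :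
    G = ⊤ ∨ ∃ t, 0 < t ∧ ND G t ∧ NU G t := by
  by_cases hD : ∃ t, ND G t
  · obtain ⟨t, ht⟩ := hD
    by_cases hU : ∃ t, NU G t
    · obtain ⟨s, hs⟩ := hU
      exact Or.inr ⟨s + t + 1, by omega, ht.mono (by omega), @ND.mono P (dualPO P) G _ _ hs (by omega)⟩
    · push Not at hU
      have hU' := (dc_dual G).1 (@dc_of_not_nd P (dualPO P) G R.dual hU)
      exact Or.inl (eq_top_of_dc_of_uc R hG (dc_of_uc R hU') hU')
  · push Not at hD
    have hD' := dc_of_not_nd R hD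
    exact Or.inl (eq_top_of_dc_of_uc R hG hD' (uc_of_dc R hD'))

/-- The common form of `ND` and `NU`: for points comparable with a large part of a finite
antichain and incomparable with another large part, the members of `G` keeping the antichain
preserve the induced bipartition of the antichain. -/
def NB (G : Subgroup (Equiv.Perm P)) (t : ℕ) : Prop :=
  ∀ (ι : Type) [Finite ι] (Y : ι → P) (x : P) (g : Equiv.Perm P) (A B : Fin t → ι), g ∈ G →
    AC Y → AC (fun i => g (Y i)) → (∀ i, x ≠ Y i) → A.Injective → B.Injective →
    (∀ k, ¬ Perp x (Y (A k))) → (∀ k, Perp x (Y (B k))) →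
    ∀ i j, (Perp x (Y i) ↔ Perp x (Y j)) ↔ (Perp (g x) (g (Y i)) ↔ Perp (g x) (g (Y j)))

theorem AC.not_le_or_not_le {ι : Type} {Y : ι → P} (hY : AC Y) {x : P} (hx : ∀ i, x ≠ Y i) :
    (∀ i, ¬ x ≤ Y i) ∨ ∀ i, ¬ Y i ≤ x := by
  by_contra! c
  obtain ⟨⟨i, hi⟩, j, hj⟩ := c
  have := hY.le_iff.1 (hj.trans hi)
  subst this
  exact hx _ (hi.antisymm hj)

theorem nb_of_nd_of_nu {G : Subgroup (Equiv.Perm P)} {t : ℕ} (hD : ND G t) (hU : NU G t) :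
    NB G t := by
  intro ι _ Y x g A B hg hY hgY hx hA hB hxA hxB
  rcases hY.not_le_or_not_le hx with h | h
  · exact hD ι Y x g A B hg hY hgY h hA hB hxA hxB
  · have := hU ι Y x g A B hg ((ac_dual _).2 hY) ((ac_dual _).2 hgY) h hA hB
      (by simpa only [perp_dual] using hxA) (by simpa only [perp_dual] using hxB)
    simpa only [perp_dual] using this

theorem NB.two_blocks {G : Subgroup (Equiv.Perm P)} {t : ℕ} (h : NB G t) (ht : 0 < t)
    {B : Blk t ⊕ Blk t → P} (hB : AC B) {k : Equiv.Perm P} (hk : k ∈ G) (hkB : ∀ s, k (B s) = B s)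
    {w : P} (hw : ∀ s, w ≠ B s) {p q p' q' : Prop} (hp : ∀ s, Perp w (B (.inl s)) ↔ p)
    (hq : ∀ s, Perp w (B (.inr s)) ↔ q) (hp' : ∀ s, Perp (k w) (B (.inl s)) ↔ p')
    (hq' : ∀ s, Perp (k w) (B (.inr s)) ↔ q') (hpq : ¬ (p ↔ q)) : ¬ (p' ↔ q') := by
  have i1 : Function.Injective fun m : Fin t => (Sum.inl (m, true) : Blk t ⊕ Blk t) :=
    fun a b e => by simpa using e
  have i2 : Function.Injective fun m : Fin t => (Sum.inr (m, true) : Blk t ⊕ Blk t) :=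
    fun a b e => by simpa using e
  by_cases c : p
  · have d : ¬ q := fun d => hpq (iff_of_true c d)
    have := h _ B w k _ _ hk hB (by simpa [hkB] using hB) hw i2 i1 (fun m => by simp [hq, d])
      (fun m => by simp [hp, c]) (.inl (⟨0, ht⟩, true)) (.inr (⟨0, ht⟩, true))
    rw [hkB, hkB, hp, hq, hp', hq'] at this
    tauto
  · have d : q := by tauto
    have := h _ B w k _ _ hk hB (by simpa [hkB] using hB) hw i1 i2 (fun m => by simp [hp, c])
      (fun m => by simp [hq, d]) (.inl (⟨0, ht⟩, true)) (.inr (⟨0, ht⟩, true))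
    rw [hkB, hkB, hp, hq, hp', hq'] at this
    tauto

theorem NB.transfer {G : Subgroup (Equiv.Perm P)} (R : Rich G) {t : ℕ} (h : NB G t) (ht : 0 < t)
    {B : Blk t ⊕ Blk t → P} {g : Equiv.Perm P} (hg : g ∈ G) (hB : AC fun s => g (B s)) {u v : P}
    (huv : Perp u v) (hu : ∀ s, u ≠ B s) (hv : ∀ s, v ≠ B s)
    (hs : ∀ s, (B s ≤ u ↔ B s ≤ v) ∧ (u ≤ B s ↔ v ≤ B s)) {p q p' q' : Prop}
    (hp : ∀ s, Perp (g u) (g (B (.inl s))) ↔ p) (hq : ∀ s, Perp (g u) (g (B (.inr s))) ↔ q)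
    (hp' : ∀ s, Perp (g v) (g (B (.inl s))) ↔ p') (hq' : ∀ s, Perp (g v) (g (B (.inr s))) ↔ q') :
    (p ↔ q) ↔ (p' ↔ q') := by
  obtain ⟨σ, hσ, -, s1, s2, s3⟩ := R.exists_swap (Set.range B) huv (by
    rintro _ ⟨s, rfl⟩
    exact hs s)
  have hk : g * σ * g⁻¹ ∈ G := G.mul_mem (G.mul_mem hg hσ) (G.inv_mem hg)
  have hkB : ∀ s, (g * σ * g⁻¹) (g (B s)) = g (B s) := fun s => by simp [s3 (B s) ⟨s, rfl⟩]
  have ku : (g * σ * g⁻¹) (g u) = g v := by simp [s1]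
  have kv : (g * σ * g⁻¹) (g v) = g u := by simp [s2]
  refine ⟨fun c => ?_, fun c => ?_⟩
  · by_contra d
    exact h.two_blocks ht hB hk hkB (fun s e => hv s (g.injective e)) hp' hq'
      (by simpa only [kv] using hp) (by simpa only [kv] using hq) d c
  · by_contra d
    exact h.two_blocks ht hB hk hkB (fun s e => hu s (g.injective e)) hp hq
      (by simpa only [ku] using hp') (by simpa only [ku] using hq') d c

open Classical in
/-- The sign of a pair of points. -/
noncomputable def sgn (a b : P) : ZMod 3 := if a < b then 1 else if b < a then -1 else 0

/-- The sum of the signs along a triple of points. -/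
noncomputable def rot (a b c : P) : ZMod 3 := sgn a b + sgn b c + sgn c a

theorem sgn_of_lt {a b : P} (h : a < b) : sgn a b = 1 := if_pos h

theorem sgn_of_gt {a b : P} (h : b < a) : sgn a b = -1 := by simp [sgn, h, h.asymm]

theorem sgn_of_perp {a b : P} (h : Perp a b) : sgn a b = 0 := by
  simp [sgn, h.not_lt, h.symm.not_lt]

theorem sgn_swap (a b : P) : sgn a b = - sgn b a := by
  by_cases h : a < b
  · rw [sgn_of_lt h, sgn_of_gt h, neg_neg]
  · by_cases h' : b < a
    · rw [sgn_of_lt h', sgn_of_gt h']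
    · simp [sgn, h, h']

theorem lt_gt_or_perp {a b : P} (h : a ≠ b) : a < b ∨ b < a ∨ Perp a b := by
  by_cases c : Perp a b
  · exact Or.inr (Or.inr c)
  · exact (lt_or_gt_of_not_perp c h).imp id Or.inl

theorem rot_cocycle (a b c d : P) : rot b c d - rot a c d + rot a b d - rot a b c = 0 := by
  unfold rot
  rw [sgn_swap d b, sgn_swap d a, sgn_swap c a]
  ring

theorem rot_swap (a b c : P) : rot b a c = - rot a b c := by
  unfold rot
  rw [sgn_swap b a, sgn_swap a c, sgn_swap c b]
  ring

theorem rot_cycle (a b c : P) : rot b c a = rot a b c := by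
  unfold rot
  ring

theorem ev_iff_rot {a b c : P} (h : a ≠ b) (h' : b ≠ c) (h'' : a ≠ c) :
    Ev a b c ↔ rot a b c = 0 := by
  unfold rot Ev
  rcases lt_gt_or_perp h with x | x | x <;> rcases lt_gt_or_perp h' with y | y | y <;>
    rcases lt_gt_or_perp h'' with z | z | z <;>
    first
    | exact absurd z.le (x.trans y).not_ge
    | exact absurd z.le (y.trans x).not_ge
    | exact absurd (x.trans y).le z.1
    | exact absurd (y.trans x).le z.2
    | exact absurd (z.trans x).le y.2
    | exact absurd (x.trans z).le y.1
    | exact absurd (y.trans z).le x.2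
    | exact absurd (z.trans y).le x.1
    | (simp only [sgn_swap c a, sgn_of_lt, sgn_of_gt, sgn_of_perp, not_perp_of_lt,
        not_perp_of_gt, x, y, z]
       decide)

theorem Ev.parity (a b c d : P) : Ev b c d ↔ (Ev a c d ↔ (Ev a b d ↔ Ev a b c)) := by
  unfold Ev
  tauto

theorem not_ev_of_sgn_eq {a b x x' y y' : P} (hab : a ≠ b) (hax : a ≠ x) (hax' : a ≠ x')
    (hay : a ≠ y) (hay' : a ≠ y') (hbx : b ≠ x) (hbx' : b ≠ x') (hby : b ≠ y) (hby' : b ≠ y')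
    (hxx' : x ≠ x') (hxy : x ≠ y) (hxy' : x ≠ y') (hx'y : x' ≠ y) (hx'y' : x' ≠ y')
    (ha : sgn a y = sgn a y') (hb : sgn b y = sgn b y') (h : ¬ Ev a b y)
    (h1 : ¬ Ev a x y) (h2 : Ev a x y') (h3 : Ev b x y) (h4 : Ev a x' y) (h5 : ¬ Ev a x' y')
    (h6 : ¬ Ev b x' y) (h7 : Ev b x' y') : ¬ Ev x x' y := by
  have e1 : Ev a b x := by
    have := Ev.parity a b x y
    tauto
  have e2 : Ev a b x' := by
    have := Ev.parity a b x' y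
    tauto
  have p1 : Ev x x' y ↔ ¬ Ev a x x' := by
    have := Ev.parity a x x' y
    tauto
  have p2 : Ev x x' y' ↔ ¬ Ev a x x' := by
    have := Ev.parity a x x' y'
    tauto
  rw [ev_iff_rot] at * <;> try assumption
  rw [ev_iff_rot hax hxx' hax'] at p1 p2
  have s : rot a b y' = rot a b y := by
    unfold rot
    rw [hb, sgn_swap y' a, sgn_swap y a, ha]
  have c1 := rot_cocycle a b x y
  have c2 := rot_cocycle a b x' y'
  have c3 := rot_cocycle a x x' y
  have c4 := rot_cocycle a x x' y'
  have q1 : rot x x' y = rot a x x' - rot a b y := by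
    linear_combination c3 + c1 - h3 + e1 + h4
  have q2 : rot x x' y' = rot a x x' + rot a b y := by
    linear_combination c4 - c2 + h7 - e2 - h2 + s
  rw [q1] at p1 ⊢
  rw [q2] at p2
  revert h p1 p2
  generalize rot a b y = s
  generalize rot a x x' = d
  revert s d
  decide

theorem exists_uniform_block {C J β : Type} [Finite C] [Fintype J] [Fintype β]
    (h : Nat.card C * Fintype.card β ≤ Fintype.card J) [Nonempty C] (f : J → C) :
    ∃ e : β ↪ J, ∃ c, ∀ s, f (e s) = c := by
  classical
  have := Fintype.ofFinite C
  rw [Nat.card_eq_fintype_card] at h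
  obtain ⟨c, hc⟩ := Fintype.exists_le_card_fiber_of_mul_le_card f h
  rw [← Fintype.card_subtype] at hc
  obtain ⟨e⟩ := Function.Embedding.nonempty_of_card_le hc
  exact ⟨e.trans (Function.Embedding.subtype _), c, fun s => (e s).2⟩

theorem perp_iff_sgn {a b : P} (h : a ≠ b) : Perp a b ↔ sgn a b = 0 := by
  refine ⟨sgn_of_perp, fun c => ?_⟩
  rcases lt_gt_or_perp h with d | d | d
  · rw [sgn_of_lt d] at c
    exact absurd c (by decide)
  · rw [sgn_of_gt d] at c
    exact absurd c (by decide)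
  · exact d

/-- Index type of two families of `m` points. -/
abbrev Wide (m : ℕ) : Type := Fin m ⊕ Fin m

/-- Index type of an antichain over which the points indexed by `Wide m` are in general position,
with many indices for each incidence pattern. -/
abbrev Base (m t : ℕ) : Type := (Wide m → Bool) × Blk t × Bool

/-- If the sets of members of an antichain comparable with two points are in general position,
the two points are comparable exactly if they lie on different sides of the antichain. -/
theorem sides {m t : ℕ} (ht : 0 < t) {Y : Base m t → P} (hY : AC Y) {x x' : P} {j j' : Wide m}
    (hj : j ≠ j') {e e' : Prop} (hx : ∀ k, x ≠ Y k) (hx' : ∀ k, x' ≠ Y k)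
    (h : ∀ k, Perp x (Y k) ↔ ¬ (k.1 j = true ↔ e))
    (h' : ∀ k, Perp x' (Y k) ↔ ¬ (k.1 j' = true ↔ e')) :
    ((∃ k, Y k ≤ x) → (∃ k, Y k ≤ x') → Perp x x') ∧
    ((∃ k, Y k ≤ x) → (¬ ∃ k, Y k ≤ x') → x' < x) ∧
    ((¬ ∃ k, Y k ≤ x) → (∃ k, Y k ≤ x') → x < x') ∧
    ((¬ ∃ k, Y k ≤ x) → (¬ ∃ k, Y k ≤ x') → Perp x x') := by
  classical
  have hex : ∀ p p' : Prop, ∃ k, (Perp x (Y k) ↔ p) ∧ (Perp x' (Y k) ↔ p') := by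
    intro p p'
    refine ⟨(fun i => if i = j then decide (¬ (p ↔ e)) else decide (¬ (p' ↔ e')), (⟨0, ht⟩, true),
      true), ?_, ?_⟩
    · rw [h]
      simp only [if_true, decide_eq_true_eq]
      tauto
    · rw [h']
      simp only [if_neg hj.symm, decide_eq_true_eq]
      tauto
  have side : ∀ z, (∀ k, z ≠ Y k) → (∃ k, Y k ≤ z) → ∀ k, ¬ z ≤ Y k := fun z hz hk => by
    rcases hY.not_le_or_not_le hz with c | c
    · exact c
    · exact (c _ hk.choose_spec).elim
  obtain ⟨k₁, k1, k1'⟩ := hex True False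
  obtain ⟨k₂, k2, k2'⟩ := hex False True
  obtain ⟨k₃, k3, k3'⟩ := hex False False
  simp only [iff_true, iff_false] at k1 k1' k2 k2' k3 k3'
  have comp : ∀ z k, ¬ Perp z (Y k) → z ≤ Y k ∨ Y k ≤ z := fun z k c => by
    by_contra! d
    exact c d
  refine ⟨fun c c' => ?_, fun c c' => ?_, fun c c' => ?_, fun c c' => ?_⟩
  · have s := side x hx c
    have s' := side x' hx' c'
    exact ⟨fun l => k2'.2 (((comp _ _ k2).resolve_left (s _)).trans l),
      fun l => k1.2 (((comp _ _ k1').resolve_left (s' _)).trans l)⟩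
  · have s := side x hx c
    push Not at c'
    have u := (comp _ _ k3).resolve_left (s _)
    have v := (comp _ _ k3').resolve_right (c' _)
    exact lt_of_le_of_lt v (u.lt_of_ne (hx _).symm)
  · have s := side x' hx' c'
    push Not at c
    have u := (comp _ _ k3').resolve_left (s _)
    have v := (comp _ _ k3).resolve_right (c _)
    exact lt_of_le_of_lt v (u.lt_of_ne (hx' _).symm)
  · push Not at c c'
    exact ⟨fun l => k1.1 (l.trans ((comp _ _ k1').resolve_right (c' _))),
      fun l => k2'.1 (l.trans ((comp _ _ k2).resolve_right (c _)))⟩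

theorem ev_aux {p q c e k : Prop} (h : (p ↔ q) ↔ ¬ (c ↔ e)) :
    (p ↔ (¬ (k ↔ e) ↔ q)) ↔ (c ↔ k) := by
  tauto

theorem iff_aux {p k e : Prop} (h : (¬ k ↔ False) ↔ (p ↔ e)) : p ↔ ¬ (k ↔ ¬ e) := by
  tauto

theorem star_transfer {G : Subgroup (Equiv.Perm P)} (R : Rich G) {m t : ℕ} (hN : NB G t)
    (ht : 0 < t) {Y : Base m t → P} (hY : AC Y) {u : P} (huY : ∀ k, Perp u (Y k))
    {g : Equiv.Perm P} (hg : g ∈ G) (hgY : AC fun k => g (Y k)) {x : Blk t → P}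
    (f : Blk t ↪ Wide m) (hx : ∀ k s, Y k ≤ x s ↔ k.1 (f s) = true) (hx' : ∀ k s, ¬ x s ≤ Y k)
    {c : Bool} (hu : ∀ s, u ≤ x s ↔ c = true) (hu' : ∀ s, ¬ x s ≤ u) {e d p q : Prop}
    (he : ∀ k s, Perp (g (x s)) (g (Y k)) ↔ ¬ (k.1 (f s) = true ↔ e))
    (hd : ∀ s, (∃ k, g (Y k) ≤ g (x s)) ↔ d) (hp : ∀ s, Perp (g u) (g (x s)) ↔ p)
    (hq : ∀ k, Perp (g u) (g (Y k)) ↔ q) (k : Base m t) (s : Blk t) :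
    Ev (g u) (g (x s)) (g (Y k)) ↔ (c = true ↔ k.1 (f s) = true) := by
  classical
  have hxY : ∀ s k, x s ≠ Y k := fun s k h => hx' k s h.le
  have hux : ∀ s, u ≠ x s := fun s h => hu' s h.ge
  have hgx : AC fun s => g (x s) := by
    intro s s' n
    have := sides ht hgY (f.injective.ne n) (fun k h => hxY s k (g.injective h))
      (fun k h => hxY s' k (g.injective h)) (fun k => he k s) fun k => he k s'
    by_cases c : d
    · exact this.1 ((hd s).2 c) ((hd s').2 c)
    · exact this.2.2.2 (mt (hd s).1 c) (mt (hd s').1 c)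
  have hout : ∀ s s', Perp (g (x s)) (g (Y (fun _ => decide (¬ e), s', true))) := fun s s' => by
    rw [he]
    simp
  have key := hN.transfer R ht
    (B := Sum.elim x fun s => Y (fun _ => decide (¬ e), s, true)) hg (by
      rintro (s | s) (s' | s') n
      · exact hgx _ _ (by simpa using n)
      · exact hout s s'
      · exact (hout s' s).symm
      · exact hgY _ _ (by simpa using n)) (u := u) (v := Y (fun _ => c, (⟨0, ht⟩, true), false))
    (huY _) (by
      rintro (s | s)
      · exact hux s
      · exact (huY _).ne) (by
      rintro (s | s)
      · exact (hxY _ _).symm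
      · exact fun h => absurd (hY.injective h) (by simp)) (by
      rintro (s | s)
      · simp [hx, hu, hx', hu']
      · have h1 := huY (fun _ => decide (¬ e), s, true)
        have h2 := hY (fun _ => c, (⟨0, ht⟩, true), false) (fun _ => decide (¬ e), s, true) (by simp)
        exact ⟨⟨fun h => absurd h h1.2, fun h => absurd h h2.2⟩,
          ⟨fun h => absurd h h1.1, fun h => absurd h h2.1⟩⟩) (p := p) (q := q)
    (p' := ¬ (c = true ↔ e)) (q' := True) hp (fun s => hq _) (fun s => by
      rw [perp_comm]
      exact he _ s) fun s => iff_true_intro (hgY _ _ (by simp))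
  rw [iff_true] at key
  rw [Ev, hp, he, hq]
  exact ev_aux key

theorem star_core {G : Subgroup (Equiv.Perm P)} (R : Rich G) {m t : ℕ} (h : ND G t) (hN : NB G t)
    (ht : 0 < t)
    (hm : Nat.card (Prop × Prop × Prop × Prop) * Fintype.card (Blk t) ≤ Fintype.card (Fin m))
    {a b : P} {Y : Base m t → P} (hab : Perp a b) (hY : AC Y) (haY : ∀ k, Perp a (Y k))
    (hbY : ∀ k, Perp b (Y k)) {g : Equiv.Perm P} (hg : g ∈ G) (hgY : AC fun k => g (Y k))
    {α β : ZMod 3} (hα : ∀ k, sgn (g a) (g (Y k)) = α) (hβ : ∀ k, sgn (g b) (g (Y k)) = β)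
    (hev : ∀ k, ¬ Ev (g a) (g b) (g (Y k))) : False := by
  classical
  have hZ : AC fun o : Option (Option (Base m t)) => o.elim a fun o => o.elim b Y := by
    rintro (_ | _ | k) (_ | _ | l) n
    · exact (n rfl).elim
    · exact hab
    · exact haY l
    · exact hab.symm
    · exact (n rfl).elim
    · exact hbY l
    · exact (haY k).symm
    · exact (hbY k).symm
    · exact hY k l (by simpa using n)
  obtain ⟨X, hX, hXS, hXD⟩ := R.lev hZ fun j : Wide m => {o | o.elim (j.isLeft = true) fun o =>
    o.elim (j.isRight = true) fun k => k.1 j = true}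
  have ha : ∀ j, a ≤ X j ↔ j.isLeft = true := hXS none
  have hb : ∀ j, b ≤ X j ↔ j.isRight = true := hXS (some none)
  have hk : ∀ k j, Y k ≤ X j ↔ k.1 j = true := fun k => hXS (some (some k))
  have ha' : ∀ j, ¬ X j ≤ a := hXD none
  have hb' : ∀ j, ¬ X j ≤ b := hXD (some none)
  have hk' : ∀ k j, ¬ X j ≤ Y k := fun k => hXD (some (some k))
  clear hXS hXD hZ
  have hXY : ∀ j k, Perp (X j) (Y k) ↔ ¬ k.1 j = true := fun j k => by
    simp [Perp, hk, hk']
  have hne : ∀ j k, g (X j) ≠ g (Y k) := fun j k c => hk' k j (g.injective c).le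
  obtain ⟨s₀⟩ : Nonempty (Blk t) := ⟨(⟨0, ht⟩, true)⟩
  have hE : ∀ j k, Perp (g (X j)) (g (Y k)) ↔
      ¬ (k.1 j = true ↔ ¬ Perp (g (X j)) (g (Y (fun _ => true, s₀, true)))) := by
    intro j k
    have := hN _ Y (X j) g (fun i => (fun _ => true, (i, true), true))
      (fun i => (fun _ => false, (i, true), true)) hg hY hgY (fun i c => hk' i j c.le)
      (fun i i' => by simp) (fun i i' => by simp) (by simp [hXY]) (by simp [hXY]) k
      (fun _ => true, s₀, true)
    rw [hXY, hXY] at this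
    exact iff_aux (by simpa only [not_true] using this)
  have hside : ∀ j k, ¬ Perp (g (X j)) (g (Y k)) → ((∃ k, g (Y k) ≤ g (X j)) ∧ g (Y k) < g (X j)) ∨
      ((¬ ∃ k, g (Y k) ≤ g (X j)) ∧ g (X j) < g (Y k)) := by
    intro j k c
    rcases lt_or_gt_of_not_perp c (hne j k) with l | l
    · refine Or.inr ⟨?_, l⟩
      rcases hgY.not_le_or_not_le (hne j) with d | d
      · exact absurd l.le (d k)
      · push Not
        exact d
    · exact Or.inl ⟨⟨k, l.le⟩, l⟩
  obtain ⟨eL, ⟨eL', dL, pa, pb⟩, hL⟩ := exists_uniform_block hm fun j : Fin m =>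
    (¬ Perp (g (X (.inl j))) (g (Y (fun _ => true, s₀, true))),
      (∃ k, g (Y k) ≤ g (X (.inl j))), Perp (g a) (g (X (.inl j))), Perp (g b) (g (X (.inl j))))
  obtain ⟨eR, ⟨eR', dR, ra, rb⟩, hR⟩ := exists_uniform_block hm fun j : Fin m =>
    (¬ Perp (g (X (.inr j))) (g (Y (fun _ => true, s₀, true))),
      (∃ k, g (Y k) ≤ g (X (.inr j))), Perp (g a) (g (X (.inr j))), Perp (g b) (g (X (.inr j))))
  simp only [Prod.mk.injEq, eq_iff_iff] at hL hR
  have hEL : ∀ k s, Perp (g (X (.inl (eL s)))) (g (Y k)) ↔ ¬ (k.1 (.inl (eL s)) = true ↔ eL') :=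
    fun k s => by rw [hE, (hL s).1]
  have hER : ∀ k s, Perp (g (X (.inr (eR s)))) (g (Y k)) ↔ ¬ (k.1 (.inr (eR s)) = true ↔ eR') :=
    fun k s => by rw [hE, (hR s).1]
  have haq : ∀ k, Perp (g a) (g (Y k)) ↔ α = 0 := fun k => by
    rw [perp_iff_sgn (fun c => (haY k).ne (g.injective c)), hα]
  have hbq : ∀ k, Perp (g b) (g (Y k)) ↔ β = 0 := fun k => by
    rw [perp_iff_sgn (fun c => (hbY k).ne (g.injective c)), hβ]
  have kaL := star_transfer R hN ht hY haY hg hgY (x := fun s => X (.inl (eL s)))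
    (eL.trans ⟨_, Sum.inl_injective⟩) (fun k s => hk k _) (fun k s => hk' k _) (c := true)
    (fun s => by simp [ha]) (fun s => ha' _) hEL (fun s => (hL s).2.1) (fun s => (hL s).2.2.1) haq
  have kbL := star_transfer R hN ht hY hbY hg hgY (x := fun s => X (.inl (eL s)))
    (eL.trans ⟨_, Sum.inl_injective⟩) (fun k s => hk k _) (fun k s => hk' k _) (c := false)
    (fun s => by simp [hb]) (fun s => hb' _) hEL (fun s => (hL s).2.1) (fun s => (hL s).2.2.2) hbq
  have kaR := star_transfer R hN ht hY haY hg hgY (x := fun s => X (.inr (eR s)))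
    (eR.trans ⟨_, Sum.inr_injective⟩) (fun k s => hk k _) (fun k s => hk' k _) (c := false)
    (fun s => by simp [ha]) (fun s => ha' _) hER (fun s => (hR s).2.1) (fun s => (hR s).2.2.1) haq
  have kbR := star_transfer R hN ht hY hbY hg hgY (x := fun s => X (.inr (eR s)))
    (eR.trans ⟨_, Sum.inr_injective⟩) (fun k s => hk k _) (fun k s => hk' k _) (c := true)
    (fun s => by simp [hb]) (fun s => hb' _) hER (fun s => (hR s).2.1) (fun s => (hR s).2.2.2) hbq
  have gne : ∀ {p q : P}, p ≠ q → g p ≠ g q := fun n c => n (g.injective c)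
  have nX : ∀ {j j'}, j ≠ j' → X j ≠ X j' := fun n => hX.injective.ne n
  have naX : ∀ j, a ≠ X j := fun j c => ha' j c.ge
  have nbX : ∀ j, b ≠ X j := fun j c => hb' j c.ge
  have hev' := not_ev_of_sgn_eq (gne hab.ne) (gne (naX (.inl (eL s₀)))) (gne (naX (.inr (eR s₀))))
    (gne (haY (fun _ => false, s₀, true)).ne) (gne (haY (fun _ => true, s₀, true)).ne)
    (gne (nbX _)) (gne (nbX _)) (gne (hbY _).ne) (gne (hbY _).ne) (gne (nX (by simp)))
    (hne _ _) (hne _ _) (hne _ _) (hne _ _) ((hα _).trans (hα _).symm) ((hβ _).trans (hβ _).symm)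
    (hev _)
    (by rw [kaL]; simp) (by rw [kaL]) (by rw [kbL]) (by rw [kaR])
    (by rw [kaR]; simp) (by rw [kbR]; simp) (by rw [kbR])
  have sLL : ∀ s s', s ≠ s' → Perp (g (X (.inl (eL s)))) (g (X (.inl (eL s')))) := fun s s' n => by
    have := sides ht hgY (Sum.inl_injective.ne (eL.injective.ne n)) (hne _) (hne _)
      (fun k => hEL k s) fun k => hEL k s'
    rw [(hL s).2.1, (hL s').2.1] at this
    by_cases c : dL
    · exact this.1 c c
    · exact this.2.2.2 c c
  have sRR : ∀ s s', s ≠ s' → Perp (g (X (.inr (eR s)))) (g (X (.inr (eR s')))) := fun s s' n => by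
    have := sides ht hgY (Sum.inr_injective.ne (eR.injective.ne n)) (hne _) (hne _)
      (fun k => hER k s) fun k => hER k s'
    rw [(hR s).2.1, (hR s').2.1] at this
    by_cases c : dR
    · exact this.1 c c
    · exact this.2.2.2 c c
  have sLR : (∀ s s', g (X (.inl (eL s))) < g (X (.inr (eR s')))) ∨
      (∀ s s', g (X (.inr (eR s'))) < g (X (.inl (eL s)))) ∨
      ∀ s s', Perp (g (X (.inl (eL s)))) (g (X (.inr (eR s')))) := by
    have : ∀ s s', _ := fun s s' => sides ht hgY (Sum.inl_ne_inr (a := eL s) (b := eR s')) (hne _)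
      (hne _) (fun k => hEL k s) fun k => hER k s'
    simp only [(hL _).2.1, (hR _).2.1] at this
    by_cases c : dL <;> by_cases d : dR
    · exact Or.inr (Or.inr fun s s' => (this s s').1 c d)
    · exact Or.inr (Or.inl fun s s' => (this s s').2.1 c d)
    · exact Or.inl fun s s' => (this s s').2.2.1 c d
    · exact Or.inr (Or.inr fun s s' => (this s s').2.2.2 c d)
  have sLY : (∀ s s', g (X (.inl (eL s))) < g (Y (fun _ => false, s', true))) ∨
      (∀ s s', g (Y (fun _ => false, s', true)) < g (X (.inl (eL s)))) ∨
      ∀ s s', Perp (g (X (.inl (eL s)))) (g (Y (fun _ => false, s', true))) := by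
    by_cases c : eL'
    · exact Or.inr (Or.inr fun s s' => by simp [hEL, c])
    · by_cases d : dL
      · refine Or.inr (Or.inl fun s s' => ?_)
        exact ((hside _ _ (by simp [hEL, c])).resolve_right fun i => i.1 ((hL s).2.1.2 d)).2
      · refine Or.inl fun s s' => ?_
        exact ((hside _ _ (by simp [hEL, c])).resolve_left fun i => d ((hL s).2.1.1 i.1)).2
  have sRY : (∀ s s', g (X (.inr (eR s))) < g (Y (fun _ => false, s', true))) ∨
      (∀ s s', g (Y (fun _ => false, s', true)) < g (X (.inr (eR s)))) ∨
      ∀ s s', Perp (g (X (.inr (eR s)))) (g (Y (fun _ => false, s', true))) := by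
    by_cases c : eR'
    · exact Or.inr (Or.inr fun s s' => by simp [hER, c])
    · by_cases d : dR
      · refine Or.inr (Or.inl fun s s' => ?_)
        exact ((hside _ _ (by simp [hER, c])).resolve_right fun i => i.1 ((hR s).2.1.2 d)).2
      · refine Or.inl fun s s' => ?_
        exact ((hside _ _ (by simp [hER, c])).resolve_left fun i => d ((hR s).2.1.1 i.1)).2
  refine hev' (h.ev_of_blocks R ht (B := ![fun s => X (.inl (eL s)), fun s => X (.inr (eR s)),
    fun s => Y (fun _ => false, s, true)]) ?_ hg ?_ ?_ s₀ s₀ s₀)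
  · have hXY0 : ∀ j s, Perp (X j) (Y (fun _ => false, s, true)) := fun j s => by simp [hXY]
    rintro ⟨k, s⟩ ⟨l, s'⟩ n
    fin_cases k <;> fin_cases l
    · exact hX _ _ (by simpa using n)
    · exact hX _ _ (by simp)
    · exact hXY0 _ _
    · exact hX _ _ (by simp)
    · exact hX _ _ (by simpa using n)
    · exact hXY0 _ _
    · exact (hXY0 _ _).symm
    · exact (hXY0 _ _).symm
    · exact hY _ _ (by simpa using n)
  · intro k s s' n
    fin_cases k
    · exact sLL s s' n
    · exact sRR s s' n
    · exact hgY _ _ (by simpa using n)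
  · intro k l n
    have flip : ∀ {f f' : Blk t → P}, ((∀ s s', f s < f' s') ∨ (∀ s s', f' s' < f s) ∨
        ∀ s s', Perp (f s) (f' s')) → ((∀ s s', f' s < f s') ∨ (∀ s s', f s' < f' s) ∨
        ∀ s s', Perp (f' s) (f s')) := by
      rintro f f' (c | c | c)
      · exact Or.inr (Or.inl fun s s' => c _ _)
      · exact Or.inl fun s s' => c _ _
      · exact Or.inr (Or.inr fun s s' => (c _ _).symm)
    fin_cases k <;> fin_cases l
    · exact (n rfl).elim
    · exact sLR
    · exact sLY
    · exact flip sLR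
    · exact (n rfl).elim
    · exact sRY
    · exact flip sLY
    · exact flip sRY
    · exact (n rfl).elim

theorem exists_ac_subseq {G : Subgroup (Equiv.Perm P)} (R : Rich G) {t : ℕ} (hD : ND G t)
    (hU : NU G t) (ht : 0 < t) {Y : ℕ → P} (hY : AC Y) {g : Equiv.Perm P} (hg : g ∈ G) :
    ∃ φ : ℕ ↪ ℕ, AC fun i => g (Y (φ i)) := by
  obtain ⟨φ, hφ⟩ := exists_increasing_or_nonincreasing_subseq (fun x y : P => x < y)
    fun i => g (Y i)
  obtain ⟨ψ, hψ⟩ := exists_increasing_or_nonincreasing_subseq (fun x y : P => y < x)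
    fun i => g (Y (φ i))
  replace hφ := hφ.resolve_left fun c =>
    hD.not_strictMono R ht (hY.comp φ.injective) hg fun i j => c i j
  replace hψ := hψ.resolve_left fun c =>
    @ND.not_strictMono P (dualPO P) G R.dual t hU ht (fun i => Y (φ (ψ i)))
      ((ac_dual _).2 (hY.comp (f := fun i => φ (ψ i)) (φ.injective.comp ψ.injective))) g hg
      fun i j => c i j
  have key : ∀ i j, i < j → Perp (g (Y (φ (ψ i)))) (g (Y (φ (ψ j)))) := fun i j l => by
    have n : g (Y (φ (ψ i))) ≠ g (Y (φ (ψ j))) := fun e =>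
      l.ne (ψ.injective (φ.injective (hY.injective (g.injective e))))
    rcases lt_gt_or_perp n with c | c | c
    · exact absurd c (hφ _ _ (ψ.strictMono l))
    · exact absurd c (hψ _ _ l)
    · exact c
  refine ⟨⟨fun i => φ (ψ i), φ.injective.comp ψ.injective⟩, fun i j n => ?_⟩
  rcases lt_or_gt_of_ne n with l | l
  · exact key i j l
  · exact (key j i l).symm

/-- Members of `G` map triples of pairwise incomparable points to triples in `Pari`. -/
theorem ev_of_perp {G : Subgroup (Equiv.Perm P)} (R : Rich G) {t : ℕ} (hD : ND G t)
    (hU : NU G t) (ht : 0 < t) {a b c : P} (hab : Perp a b) (hbc : Perp b c) (hac : Perp a c)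
    {g : Equiv.Perm P} (hg : g ∈ G) : Ev (g a) (g b) (g c) := by
  by_contra hev
  obtain ⟨Y, hY, hYp⟩ := R.exists_ac_nat {a, b, c}
  obtain ⟨φ, hφ⟩ := exists_ac_subseq R hD hU ht hY hg
  obtain ⟨⟨α, β, γ⟩, hc⟩ := Finite.exists_infinite_fiber fun i =>
    (sgn (g a) (g (Y (φ i))), sgn (g b) (g (Y (φ i))), sgn (g c) (g (Y (φ i))))
  obtain ⟨ψ, hψ⟩ : ∃ ψ : ℕ ↪ ℕ, ∀ i, sgn (g a) (g (Y (φ (ψ i)))) = α ∧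
      sgn (g b) (g (Y (φ (ψ i)))) = β ∧ sgn (g c) (g (Y (φ (ψ i)))) = γ := by
    have e := Infinite.natEmbedding ↑((fun i => (sgn (g a) (g (Y (φ i))), sgn (g b) (g (Y (φ i))),
      sgn (g c) (g (Y (φ i))))) ⁻¹' {(α, β, γ)})
    refine ⟨e.trans (Function.Embedding.subtype _), fun i => ?_⟩
    have := (e i).2
    rwa [Set.mem_preimage, Set.mem_singleton_iff, Prod.mk.injEq, Prod.mk.injEq] at this
  set m := Nat.card (Prop × Prop × Prop × Prop) * Fintype.card (Blk t) with hm
  set Z : Base m t → P := fun k => Y (φ (ψ (Finite.equivFin (Base m t) k))) with hZ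
  have hinj : Function.Injective fun k : Base m t => ψ (Finite.equivFin (Base m t) k) :=
    ψ.injective.comp (Fin.val_injective.comp (Finite.equivFin _).injective)
  have hZac : AC Z := hY.comp (f := fun k => φ (ψ (Finite.equivFin (Base m t) k)))
    (φ.injective.comp hinj)
  have hgZ : AC fun k => g (Z k) := hφ.comp hinj
  have pa : ∀ k, Perp a (Z k) := fun k => hYp _ a (by simp)
  have pb : ∀ k, Perp b (Z k) := fun k => hYp _ b (by simp)
  have pc : ∀ k, Perp c (Z k) := fun k => hYp _ c (by simp)
  have sa : ∀ k, sgn (g a) (g (Z k)) = α := fun k => (hψ _).1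
  have sb : ∀ k, sgn (g b) (g (Z k)) = β := fun k => (hψ _).2.1
  have sc : ∀ k, sgn (g c) (g (Z k)) = γ := fun k => (hψ _).2.2
  have core : ∀ {u v : P} {μ ν : ZMod 3}, Perp u v → (∀ k, Perp u (Z k)) → (∀ k, Perp v (Z k)) →
      (∀ k, sgn (g u) (g (Z k)) = μ) → (∀ k, sgn (g v) (g (Z k)) = ν) →
      ∀ k, Ev (g u) (g v) (g (Z k)) := by
    intro u v μ ν huv pu pv su sv k
    by_contra hk
    refine star_core R hD (nb_of_nd_of_nu hD hU) ht (by simp [hm]) huv hZac pu pv hg hgZ su sv ?_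
    intro l
    rw [Ev, perp_iff_sgn fun e => (pv l).ne (g.injective e),
      perp_iff_sgn fun e => (pu l).ne (g.injective e), su, sv]
    rwa [Ev, perp_iff_sgn fun e => (pv k).ne (g.injective e),
      perp_iff_sgn fun e => (pu k).ne (g.injective e), su, sv] at hk
  have k₀ : Base m t := (fun _ => true, (⟨0, ht⟩, true), true)
  have := Ev.parity (g a) (g b) (g c) (g (Z k₀))
  simp only [core hab pa pb sa sb k₀, core hbc pb pc sb sc k₀, core hac pa pc sa sc k₀, hev] at this
  simp at this

/-- `G` maps triples of pairwise incomparable points to triples in `Pari`. -/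
def PerpToPari (G : Subgroup (Equiv.Perm P)) : Prop :=
  ∀ a b c : P, Perp a b → Perp b c → Perp a c → ∀ g ∈ G, Ev (g a) (g b) (g c)

/-- Some member of `G` makes the triple pairwise incomparable. -/
def Flat (G : Subgroup (Equiv.Perm P)) (a b c : P) : Prop :=
  ∃ g ∈ G, Perp (g a) (g b) ∧ Perp (g b) (g c) ∧ Perp (g a) (g c)

theorem Flat.cycle {G : Subgroup (Equiv.Perm P)} {a b c : P} (h : Flat G a b c) : Flat G b c a := by
  obtain ⟨g, hg, h1, h2, h3⟩ := h
  exact ⟨g, hg, h2, h3.symm, h1.symm⟩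

theorem flat_apply {G : Subgroup (Equiv.Perm P)} {a b c : P} {g : Equiv.Perm P} (hg : g ∈ G) :
    Flat G (g a) (g b) (g c) ↔ Flat G a b c := by
  constructor
  · rintro ⟨k, hk, h⟩
    exact ⟨k * g, G.mul_mem hk hg, h⟩
  · rintro ⟨k, hk, h⟩
    exact ⟨k * g⁻¹, G.mul_mem hk (G.inv_mem hg), by simpa using h⟩

theorem flat_of_perp {G : Subgroup (Equiv.Perm P)} {a b c : P} (hab : Perp a b) (hbc : Perp b c)
    (hac : Perp a c) : Flat G a b c := ⟨1, G.one_mem, hab, hbc, hac⟩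

theorem PerpToPari.ev {G : Subgroup (Equiv.Perm P)} (S : PerpToPari G) {a b c : P} (h : Flat G a b c) :
    Ev a b c := by
  obtain ⟨g, hg, h1, h2, h3⟩ := h
  simpa using S _ _ _ h1 h2 h3 _ (G.inv_mem hg)

theorem Flat.of_lt {G : Subgroup (Equiv.Perm P)} (R : Rich G) {x y z x' y' z' : P} (hxy : x < y)
    (hxz : x < z) (hyz : Perp y z) (hxy' : x' < y') (hxz' : x' < z') (hyz' : Perp y' z')
    (h : Flat G x y z) : Flat G x' y' z' := by
  obtain ⟨k, hk, -, e⟩ := R.hom ![x', y', z'] ![x, y, z] (by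
    intro i j
    fin_cases i <;> fin_cases j <;>
      simp [hxy.le, hxz.le, hxy.not_ge, hxz.not_ge, hyz.1, hyz.2, hxy'.le, hxz'.le, hxy'.not_ge,
        hxz'.not_ge, hyz'.1, hyz'.2])
  have e0 := e 0
  have e1 := e 1
  have e2 := e 2
  simp at e0 e1 e2
  rw [← flat_apply hk, e0, e1, e2]
  exact h

/-- It is impossible that exactly the triples with a minimum can be made incomparable. -/
theorem PerpToPari.flat_of_gt {G : Subgroup (Equiv.Perm P)} (R : Rich G) (S : PerpToPari G)
    (hV : ∀ x y z : P, x < y → x < z → Perp y z → Flat G x y z)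
    (hL : ∀ x y z : P, y < x → z < x → Perp y z → ¬ Flat G x y z) : False := by
  obtain ⟨a, b, g, hg, hab, hgab⟩ : ∃ a b, ∃ g ∈ G, Perp a b ∧ g a < g b := by
    obtain ⟨y, -⟩ := R.exists_perp ∅
    obtain ⟨z, hz⟩ := R.exists_perp {y}
    obtain ⟨x, hx⟩ := R.pt {y, z} ∅ {y, z} (by simp)
    have hyz : Perp y z := hz y rfl
    have hxy : x < y := by
      have := hx y (by simp)
      simp at this
      exact lt_of_le_not_ge this.2 this.1
    have hxz : x < z := by
      have := hx z (by simp)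
      simp at this
      exact lt_of_le_not_ge this.2 this.1
    obtain ⟨g, hg, h1, h2, h3⟩ := hV x y z hxy hxz hyz
    exact ⟨g x, g y, g⁻¹, G.inv_mem hg, h1, by simpa⟩
  obtain ⟨y, hy, hyp⟩ := R.exists_ac {a, b} (Fin 4)
  have hay : ∀ i, Perp a (y i) := fun i => hyp i a (by simp)
  have hby : ∀ i, Perp b (y i) := fun i => hyp i b (by simp)
  have h1 : ∀ i, Perp (g b) (g (y i)) ∧ g a < g (y i) := by
    intro i
    have hf : Flat G (g b) (g a) (g (y i)) :=
      (flat_apply hg).2 (flat_of_perp hab.symm (hay i) (hby i))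
    have ev := S.ev hf
    have n : g a ≠ g (y i) := fun e => (hay i).ne (g.injective e)
    have n' : g b ≠ g (y i) := fun e => (hby i).ne (g.injective e)
    simp only [Ev, not_perp_of_gt hgab, false_iff] at ev
    by_cases c : Perp (g b) (g (y i))
    · simp only [c, iff_true] at ev
      rcases lt_or_gt_of_not_perp ev n with d | d
      · exact ⟨c, d⟩
      · exact absurd (d.trans hgab).le c.2
    · simp only [c, iff_false, not_not] at ev
      rcases lt_or_gt_of_not_perp c n' with d | d
      · exact absurd (hgab.trans d).le ev.1
      · exact absurd hf (hL _ _ _ hgab d ev)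
  have h2 : ∀ i j, i ≠ j → Perp (g (y i)) (g (y j)) := by
    intro i j n
    have := S b (y i) (y j) (hby i) (hy i j n) (hby j) g hg
    simpa [Ev, (h1 i).1, (h1 j).1] using this
  obtain ⟨z', hz'⟩ := R.pt (insert (g a) (Set.range fun i => g (y i))) ∅ {g (y 0), g (y 1)} (by simp)
  have hza : Perp z' (g a) := by
    have := hz' (g a) (by simp)
    simp [(h1 _).2.not_ge] at this
    exact this.symm
  have hzy : ∀ i, ¬ g (y i) ≤ z' ∧ (z' ≤ g (y i) ↔ g (y 0) ≤ g (y i) ∨ g (y 1) ≤ g (y i)) := fun i => by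
    have := hz' (g (y i)) (by simp)
    simpa using this
  have hz0 : z' < g (y 0) := lt_of_le_not_ge ((hzy 0).2.2 (by simp)) (hzy 0).1
  have hz1 : z' < g (y 1) := lt_of_le_not_ge ((hzy 1).2.2 (by simp)) (hzy 1).1
  have hz2 : Perp z' (g (y 2)) :=
    ⟨by simp [(hzy 2).2, (h2 0 2 (by decide)).1, (h2 1 2 (by decide)).1], (hzy 2).1⟩
  have hz3 : Perp z' (g (y 3)) :=
    ⟨by simp [(hzy 3).2, (h2 0 3 (by decide)).1, (h2 1 3 (by decide)).1], (hzy 3).1⟩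
  obtain ⟨z, rfl⟩ := g.surjective z'
  have r01 : Flat G z (y 0) (y 1) := (flat_apply hg).1 (hV _ _ _ hz0 hz1 (h2 0 1 (by decide)))
  have r23 : Flat G z (y 2) (y 3) := (flat_apply hg).1 (flat_of_perp hz2 (h2 2 3 (by decide)) hz3)
  have r02 : ¬ Flat G z (y 0) (y 2) := fun c => by
    have := S.ev ((flat_apply hg).2 c)
    simp [Ev, not_perp_of_lt hz0, hz2, h2 0 2 (by decide)] at this
  have ra0 : ¬ Flat G z a (y 0) := fun c =>
    hL _ _ _ hz0 (h1 0).2 hza ((flat_apply hg).2 c).cycle.cycle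
  have ra2 : ¬ Flat G z a (y 2) := fun c => by
    have := S.ev ((flat_apply hg).2 c)
    simp [Ev, not_perp_of_lt (h1 2).2, hz2, hza] at this
  have hA : AC fun o : Option (Fin 4) => o.elim a y := by
    rintro (_ | k) (_ | l) n
    · exact (n rfl).elim
    · exact hay l
    · exact (hay k).symm
    · exact hy k l (by simpa using n)
  have hz : ∀ o : Option (Fin 4), z ≠ o.elim a y := by
    rintro (_ | i) e
    · subst e
      exact hza.ne rfl
    · exact (hzy i).1 (congrArg g e).ge
  have even : ∀ p q : P, Perp p q → Flat G z p q → (Perp z p ↔ Perp z q) := fun p q hpq hf => by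
    have := S.ev hf
    simpa [Ev, hpq] using this
  have e01 := even _ _ (hy 0 1 (by decide)) r01
  have e23 := even _ _ (hy 2 3 (by decide)) r23
  rcases hA.not_le_or_not_le hz with c | c
  · have key : ∀ i j, i ≠ j → Flat G z (y i) (y j) → Perp z (y i) := fun i j n hf => by
      by_contra d
      have d' : ¬ Perp z (y j) := by rwa [← even _ _ (hy i j n) hf]
      exact hL _ _ _ ((lt_or_gt_of_not_perp d (hz (some i))).resolve_left fun l => c (some i) l.le)
        ((lt_or_gt_of_not_perp d' (hz (some j))).resolve_left fun l => c (some j) l.le) (hy i j n) hf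
    exact r02 (flat_of_perp (key _ _ (by decide) r01) (hy _ _ (by decide)) (key _ _ (by decide) r23))
  · have key : ∀ o o' : Option (Fin 4), o ≠ o' → ¬ Flat G z (o.elim a y) (o'.elim a y) →
        ¬ (Perp z (o.elim a y) ↔ Perp z (o'.elim a y)) := fun o o' n hf d => by
      by_cases e : Perp z (o.elim a y)
      · exact hf (flat_of_perp e (hA _ _ n) (d.1 e))
      · have e' := mt d.2 e
        exact hf (hV _ _ _ ((lt_or_gt_of_not_perp e (hz o)).resolve_right fun l => c _ l.le)
          ((lt_or_gt_of_not_perp e' (hz o')).resolve_right fun l => c _ l.le) (hA _ _ n))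
    have k1 := key (some 0) (some 2) (by decide) r02
    have k2 := key none (some 0) (by decide) ra0
    have k3 := key none (some 2) (by decide) ra2
    simp only [Option.elim] at k1 k2 k3
    revert k1 k2 k3
    generalize Perp z (y 0) = p
    generalize Perp z (y 2) = q
    generalize Perp z a = r
    tauto

theorem PerpToPari.dual {G : Subgroup (Equiv.Perm P)} (S : PerpToPari G) : @PerpToPari P (dualPO P) G := by
  simpa only [PerpToPari, Ev, perp_dual] using S

theorem flat_dual (G : Subgroup (Equiv.Perm P)) (a b c : P) :
    @Flat P (dualPO P) G a b c ↔ Flat G a b c := by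
  simp only [Flat, perp_dual]

/-- A group mapping antichains of three points into `Pari` preserves incomparability or `Pari`. -/
theorem PerpToPari.perp_or_ev {G : Subgroup (Equiv.Perm P)} (R : Rich G) (S : PerpToPari G) :
    (∀ g ∈ G, ∀ a b, Perp a b → Perp (g a) (g b)) ∨
    ∀ g ∈ G, ∀ a b c, a ≠ b → b ≠ c → a ≠ c → Ev a b c → Ev (g a) (g b) (g c) := by
  by_cases hV : ∀ x y z : P, x < y → x < z → Perp y z → Flat G x y z <;>
    by_cases hL : ∀ x y z : P, y < x → z < x → Perp y z → Flat G x y z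
  · refine Or.inr fun g hg a b c hab hbc hac h => S.ev ((flat_apply hg).2 ?_)
    by_cases x : Perp a b <;> by_cases y : Perp b c
    · exact flat_of_perp x y (by simpa [Ev, x, y] using h)
    · have z : ¬ Perp a c := by simpa [Ev, x, y] using h
      rcases lt_or_gt_of_not_perp y hbc with y | y <;> rcases lt_or_gt_of_not_perp z hac with z | z
      · exact (hL _ _ _ z y x).cycle
      · exact absurd (y.trans z).le x.2
      · exact absurd (z.trans y).le x.1
      · exact (hV _ _ _ z y x).cycle
    · have z : ¬ Perp a c := by simpa [Ev, x, y] using h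
      rcases lt_or_gt_of_not_perp x hab with x | x <;> rcases lt_or_gt_of_not_perp z hac with z | z
      · exact hV _ _ _ x z y
      · exact absurd (z.trans x).le y.2
      · exact absurd (x.trans z).le y.1
      · exact hL _ _ _ x z y
    · have z : Perp a c := by simpa [Ev, x, y] using h
      rcases lt_or_gt_of_not_perp x hab with x | x <;> rcases lt_or_gt_of_not_perp y hbc with y | y
      · exact absurd (x.trans y).le z.1
      · exact (hL _ _ _ y x z.symm).cycle.cycle
      · exact (hV _ _ _ y x z.symm).cycle.cycle
      · exact absurd (y.trans x).le z.2
  · push Not at hL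
    obtain ⟨x, y, z, h1, h2, h3, h4⟩ := hL
    exact (S.flat_of_gt R hV fun x' y' z' h1' h2' h3' h => h4 <| (flat_dual _ _ _ _).1 <|
      @Flat.of_lt P (dualPO P) G R.dual x' y' z' x y z h1' h2' ((perp_dual _ _).2 h3') h1 h2
        ((perp_dual _ _).2 h3) ((flat_dual _ _ _ _).2 h)).elim
  · push Not at hV
    obtain ⟨x, y, z, h1, h2, h3, h4⟩ := hV
    refine (@PerpToPari.flat_of_gt P (dualPO P) G R.dual S.dual (fun x' y' z' h1' h2' h3' => ?_)
      fun x' y' z' h1' h2' h3' h => ?_).elim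
    · exact (flat_dual _ _ _ _).2 (hL x' y' z' h1' h2' ((perp_dual _ _).1 h3'))
    · exact h4 (((flat_dual _ _ _ _).1 h).of_lt R h1' h2' ((perp_dual _ _).1 h3') h1 h2 h3)
  · push Not at hV hL
    obtain ⟨x, y, z, h1, h2, h3, h4⟩ := hV
    obtain ⟨u, v, w, k1, k2, k3, k4⟩ := hL
    replace h4 : ∀ x' y' z' : P, x' < y' → x' < z' → Perp y' z' → ¬ Flat G x' y' z' :=
      fun x' y' z' h1' h2' h3' h => h4 (h.of_lt R h1' h2' h3' h1 h2 h3)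
    replace k4 : ∀ x' y' z' : P, y' < x' → z' < x' → Perp y' z' → ¬ Flat G x' y' z' :=
      fun x' y' z' h1' h2' h3' h => k4 <| (flat_dual _ _ _ _).1 <|
      @Flat.of_lt P (dualPO P) G R.dual x' y' z' u v w h1' h2' ((perp_dual _ _).2 h3') k1 k2
        ((perp_dual _ _).2 k3) ((flat_dual _ _ _ _).2 h)
    refine Or.inl fun g hg a b hab => ?_
    by_contra hx
    obtain ⟨c, hc⟩ := R.exists_perp {a, b}
    have hac := hc a (by simp)
    have hbc := hc b (by simp)
    have hf : Flat G (g a) (g b) (g c) := (flat_apply hg).2 (flat_of_perp hab hbc hac)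
    have ev := S.ev hf
    have nab : g a ≠ g b := fun e => hab.ne (g.injective e)
    have nbc : g b ≠ g c := fun e => hbc.ne (g.injective e)
    have nac : g a ≠ g c := fun e => hac.ne (g.injective e)
    simp only [Ev, hx, false_iff] at ev
    by_cases y : Perp (g b) (g c)
    · have z : ¬ Perp (g a) (g c) := by simpa [y] using ev
      rcases lt_or_gt_of_not_perp hx nab with x | x <;> rcases lt_or_gt_of_not_perp z nac with z | z
      · exact h4 _ _ _ x z y hf
      · exact absurd (z.trans x).le y.2
      · exact absurd (x.trans z).le y.1
      · exact k4 _ _ _ x z y hf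
    · have z : Perp (g a) (g c) := by simpa [y] using ev
      rcases lt_or_gt_of_not_perp hx nab with x | x <;> rcases lt_or_gt_of_not_perp y nbc with y | y
      · exact absurd (x.trans y).le z.1
      · exact k4 _ _ _ y x z.symm hf.cycle
      · exact h4 _ _ _ y x z.symm hf.cycle
      · exact absurd (y.trans x).le z.2

/-- A property of comparable pairs which is kept when one end is replaced by an incomparable point
holds for all pairs `u < v` if it holds for one of them. -/
theorem Rich.lt_pairs {G : Subgroup (Equiv.Perm P)} (R : Rich G) {T : P → P → Prop}
    (h₁ : ∀ u v w, u < v → u < w → Perp v w → T u v → T u w)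
    (h₂ : ∀ u u' w, u < w → u' < w → Perp u u' → T u w → T u' w) {u v u' v' : P} (h : u < v)
    (h' : u' < v') (hT : T u v) : T u' v' := by
  obtain ⟨m, hm⟩ := R.exists_perp {u, v, u', v'}
  have hmu := hm u (by simp)
  have hmv := hm v (by simp)
  have hmu' := hm u' (by simp)
  have hmv' := hm v' (by simp)
  obtain ⟨w, hw⟩ := R.pt {u, v, u', v', m} {u, m} ∅ (by simp)
  have wu := hw u (by simp)
  have wv := hw v (by simp)
  have wm := hw m (by simp)
  simp at wu wv wm
  obtain ⟨w', hw'⟩ := R.pt {u, v, u', v', m, w} {u', m} ∅ (by simp)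
  have wu' := hw' u' (by simp)
  have wv' := hw' v' (by simp)
  have wm' := hw' m (by simp)
  have ww' := hw' w (by simp)
  have wu'' := hw u' (by simp)
  simp at wu' wv' wm' ww' wu''
  have l1 : u < w := lt_of_le_not_ge wu.1 wu.2
  have l2 : m < w := lt_of_le_not_ge wm.1 wm.2
  have l3 : u' < w' := lt_of_le_not_ge wu'.1 wu'.2
  have l4 : m < w' := lt_of_le_not_ge wm'.1 wm'.2
  have p1 : Perp v w := ⟨fun c => (wv.1.1 c).elim h.not_ge hmv.1, wv.2⟩
  have p2 : Perp w' v' := ⟨wv'.2, fun c => (wv'.1.1 c).elim h'.not_ge hmv'.1⟩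
  have p3 : Perp w w' := ⟨fun c => (ww'.1.1 c).elim wu''.2 wm.2, ww'.2⟩
  exact h₁ _ _ _ l3 h' p2 (h₂ _ _ _ l4 l3 hmu'.symm (h₁ _ _ _ l2 l4 p3 (h₂ _ _ _ l1 l2 hmu
    (h₁ _ _ _ h l1 p1 hT))))

theorem Rich.exists_lt {G : Subgroup (Equiv.Perm P)} (R : Rich G) (a : P) : ∃ b, a < b := by
  obtain ⟨b, hb⟩ := R.pt {a} {a} ∅ (by simp)
  have := hb a rfl
  simp at this
  exact ⟨b, lt_of_le_not_ge this.1 this.2⟩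

/-- A permutation preserving incomparability is an automorphism or an anti-automorphism. -/
theorem Rich.auto_or_anti {G : Subgroup (Equiv.Perm P)} (R : Rich G) {f : Equiv.Perm P}
    (hf : ∀ a b, Perp a b ↔ Perp (f a) (f b)) : IsOrderAuto f ∨ IsAntiAuto f := by
  have comp : ∀ {u v : P}, u < v → f u < f v ∨ f v < f u := fun h =>
    lt_or_gt_of_not_perp (fun c => not_perp_of_lt h ((hf _ _).2 c)) (f.injective.ne h.ne)
  obtain ⟨o, -⟩ := R.exists_perp ∅
  obtain ⟨o', ho⟩ := R.exists_lt o
  rcases comp ho with c | c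
  · have key : ∀ {u v : P}, u < v → f u < f v := fun h =>
      R.lt_pairs (T := fun u v => f u < f v)
        (fun u v w _ h2 h3 h4 => (comp h2).resolve_right fun d =>
          ((hf _ _).1 h3).2 (d.trans h4).le)
        (fun u v w _ h2 h3 h4 => (comp h2).resolve_right fun d =>
          ((hf _ _).1 h3).1 (h4.trans d).le) ho h c
    refine Or.inl fun a b => ?_
    rcases eq_or_ne a b with rfl | n
    · simp
    rcases lt_gt_or_perp n with d | d | d
    · exact iff_of_true (key d).le d.le
    · exact iff_of_false (key d).not_ge d.not_ge
    · exact iff_of_false ((hf _ _).1 d).1 d.1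
  · have key : ∀ {u v : P}, u < v → f v < f u := fun h =>
      R.lt_pairs (T := fun u v => f v < f u)
        (fun u v w _ h2 h3 h4 => (comp h2).resolve_left fun d =>
          ((hf _ _).1 h3).1 (h4.trans d).le)
        (fun u v w _ h2 h3 h4 => (comp h2).resolve_left fun d =>
          ((hf _ _).1 h3).2 (d.trans h4).le) ho h c
    refine Or.inr fun a b => ?_
    rcases eq_or_ne a b with rfl | n
    · simp
    rcases lt_gt_or_perp n with d | d | d
    · exact iff_of_false (key d).not_ge d.not_ge
    · exact iff_of_true (key d).le d.le
    · exact iff_of_false ((hf _ _).1 d).1 d.2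

theorem auto_or_perp_of_forall_perp {G : Subgroup (Equiv.Perm P)} (R : Rich G)
    (hAut : ∀ f : Equiv.Perm P, IsOrderAuto f → f ∈ G)
    (hp : ∀ g ∈ G, ∀ a b, Perp a b → Perp (g a) (g b)) :
    (∀ f : Equiv.Perm P, f ∈ G ↔ IsOrderAuto f) ∨
    ∀ f : Equiv.Perm P, f ∈ G ↔ ∀ a b : P, Perp a b ↔ Perp (f a) (f b) := by
  have hp' : ∀ g ∈ G, ∀ a b, Perp a b ↔ Perp (g a) (g b) := fun g hg a b =>
    ⟨hp g hg a b, fun h => by simpa using hp _ (G.inv_mem hg) _ _ h⟩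
  by_cases h : ∀ f ∈ G, IsOrderAuto f
  · exact Or.inl fun f => ⟨h f, hAut f⟩
  · push Not at h
    obtain ⟨g, hg, hg'⟩ := h
    have ha := (R.auto_or_anti (hp' g hg)).resolve_left hg'
    refine Or.inr fun f => ⟨fun hf => hp' f hf, fun hf => ?_⟩
    rcases R.auto_or_anti hf with c | c
    · exact hAut f c
    · have : f = g * (g⁻¹ * f) := by group
      rw [this]
      refine G.mul_mem hg (hAut _ fun a b => ?_)
      rw [← c b a, ← ha]
      simp

theorem sgn_self (a : P) : sgn a a = 0 := by simp [sgn]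

theorem sgn_eq_one {a b : P} : sgn a b = 1 ↔ a < b := by
  refine ⟨fun h => ?_, sgn_of_lt⟩
  by_contra c
  by_cases d : b < a
  · rw [sgn_of_gt d] at h
    exact absurd h (by decide)
  · simp [sgn, c, d] at h

theorem rot_self (a b : P) : rot a a b = 0 := by
  simp only [rot, sgn_self, sgn_swap b a]
  ring

theorem rot_of_eq {a b c : P} (h : a = b ∨ b = c ∨ a = c) : rot a b c = 0 := by
  rcases h with rfl | rfl | rfl
  · exact rot_self _ _
  · rw [← rot_cycle, rot_self]
  · rw [← rot_cycle, ← rot_cycle, rot_self]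

theorem rot_of_perp {a b c : P} (hab : Perp a b) (hbc : Perp b c) (hac : Perp a c) :
    rot a b c = 0 := by
  simp [rot, sgn_of_perp, hab, hbc, hac.symm]

theorem rot_of_min {a b c : P} (hab : a < b) (hac : a < c) (hbc : Perp b c) : rot a b c = 0 := by
  simp [rot, sgn_of_perp, sgn_of_lt, sgn_of_gt, hab, hbc, hac]

theorem rot_of_max {a b c : P} (hab : b < a) (hac : c < a) (hbc : Perp b c) : rot a b c = 0 := by
  simp [rot, sgn_of_perp, sgn_of_lt, sgn_of_gt, hab, hbc, hac]

theorem rot_of_isolated {a b c : P} (hab : a < b) (hca : Perp c a) (hcb : Perp c b) :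
    rot a b c = 1 := by
  simp [rot, sgn_of_perp, sgn_of_lt, hab, hca, hcb.symm]

theorem rot_of_chain {a b c : P} (hab : a < b) (hbc : b < c) : rot a b c = 1 := by
  simp [rot, sgn_of_lt, sgn_of_gt, hab, hbc, hab.trans hbc]

/-- The relative position of three distinct points is, up to a permutation of them, one of five. -/
theorem triple_cases {K : P → P → P → Prop} (cyc : ∀ a b c, K a b c → K b c a)
    (swap : ∀ a b c, K a b c → K b a c) (h₁ : ∀ a b c, Perp a b → Perp b c → Perp a c → K a b c)
    (h₂ : ∀ a b c, a < b → a < c → Perp b c → K a b c)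
    (h₃ : ∀ a b c, b < a → c < a → Perp b c → K a b c)
    (h₄ : ∀ a b c, a < b → Perp c a → Perp c b → K a b c)
    (h₅ : ∀ a b c, a < b → b < c → K a b c) {a b c : P} (hab : a ≠ b) (hbc : b ≠ c)
    (hac : a ≠ c) : K a b c := by
  have t₁ : K b c a → K a b c := fun h => cyc _ _ _ (cyc _ _ _ h)
  have t₂ : K c a b → K a b c := cyc _ _ _
  have t₃ : K b a c → K a b c := swap _ _ _
  have t₄ : K c b a → K a b c := fun h => cyc _ _ _ (swap _ _ _ (cyc _ _ _ (cyc _ _ _ h)))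
  have t₅ : K a c b → K a b c := fun h => cyc _ _ _ (swap _ _ _ h)
  rcases lt_gt_or_perp hab with x | x | x <;> rcases lt_gt_or_perp hbc with y | y | y <;>
    rcases lt_gt_or_perp hac with z | z | z <;>
    first
    | exact absurd z.le (x.trans y).not_ge
    | exact absurd z.le (y.trans x).not_ge
    | exact absurd (x.trans y).le z.1
    | exact absurd (y.trans x).le z.2
    | exact absurd (z.trans x).le y.2
    | exact absurd (x.trans z).le y.1
    | exact absurd (y.trans z).le x.2
    | exact absurd (z.trans y).le x.1
    | exact h₁ _ _ _ x y z
    | exact h₂ _ _ _ x z y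
    | exact t₃ (h₂ _ _ _ x y z)
    | exact t₂ (h₂ _ _ _ z y x)
    | exact h₃ _ _ _ x z y
    | exact t₃ (h₃ _ _ _ x y z)
    | exact t₂ (h₃ _ _ _ z y x)
    | exact h₄ _ _ _ x z.symm y.symm
    | exact t₃ (h₄ _ _ _ x y.symm z.symm)
    | exact t₁ (h₄ _ _ _ y x z)
    | exact t₄ (h₄ _ _ _ y z x)
    | exact t₅ (h₄ _ _ _ z x.symm y)
    | exact t₂ (h₄ _ _ _ z y x.symm)
    | exact h₅ _ _ _ x y
    | exact t₅ (h₅ _ _ _ z y)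
    | exact t₃ (h₅ _ _ _ x z)
    | exact t₁ (h₅ _ _ _ y z)
    | exact t₂ (h₅ _ _ _ z x)
    | exact t₄ (h₅ _ _ _ y x)

theorem Cyc.cycle {a b c : P} (h : Cyc a b c) : Cyc b c a := by
  unfold Cyc at h ⊢
  tauto

theorem cyc_iff_rot (a b c : P) : Cyc a b c ↔ rot a b c = 1 := by
  have irr : ∀ a b : P, ¬ Cyc a a b ∧ ¬ Cyc a b b ∧ ¬ Cyc a b a := fun a b => by
    simp only [Cyc, not_perp_self, lt_self_iff_false, false_and, and_false, or_false, false_or]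
    refine ⟨fun h => h.1.asymm h.2, fun h => h.1.asymm h.2, fun h => h.1.asymm h.2⟩
  by_cases hab : a = b
  · simp [rot_of_eq (a := a) (b := b) (c := c) (.inl hab)]
    simp [hab, irr]
  by_cases hbc : b = c
  · simp [rot_of_eq (a := a) (b := b) (c := c) (.inr (.inl hbc))]
    simp [hbc, irr]
  by_cases hac : a = c
  · simp [rot_of_eq (a := a) (b := b) (c := c) (.inr (.inr hac))]
    simp [hac, irr]
  refine (triple_cases (K := fun a b c => (Cyc a b c ↔ rot a b c = 1) ∧
    (Cyc b a c ↔ rot a b c = -1)) (fun a b c h => ?_) (fun a b c h => ?_) (fun a b c x y z => ?_)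
    (fun a b c x y z => ?_) (fun a b c x y z => ?_) (fun a b c x y z => ?_)
    (fun a b c x y => ?_) hab hbc hac).1
  · have c1 : Cyc b c a ↔ Cyc a b c := ⟨fun h => h.cycle.cycle, Cyc.cycle⟩
    have c2 : Cyc c b a ↔ Cyc b a c := ⟨fun h => h.cycle, fun h => h.cycle.cycle⟩
    rw [rot_cycle, c1, c2]
    exact h
  · rw [rot_swap, neg_inj, neg_eq_iff_eq_neg]
    exact h.symm
  · rw [rot_of_perp x y z]
    simp [Cyc, x.not_lt, y.not_lt, z.not_lt, x.symm.not_lt, y.symm.not_lt, z.symm.not_lt]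
  · rw [rot_of_min x y z]
    simp [Cyc, x, y, z, x.asymm, y.asymm, z.not_lt, z.symm.not_lt, not_perp_of_lt, not_perp_of_gt]
  · rw [rot_of_max x y z]
    simp [Cyc, x, y, z, x.asymm, y.asymm, z.not_lt, z.symm.not_lt, not_perp_of_lt, not_perp_of_gt]
  · rw [rot_of_isolated x y z]
    simp [Cyc, x, y, z, x.asymm, y.not_lt, y.symm.not_lt, z.not_lt, z.symm.not_lt]
    decide
  · rw [rot_of_chain x y]
    simp [Cyc, x, y, x.asymm, y.asymm, not_perp_of_lt, not_perp_of_gt]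
    decide

theorem Pari.cycle {a b c : P} (h : Pari a b c) : Pari b c a := by
  rcases h with ⟨x, y, z⟩ | ⟨x, y, z⟩ | ⟨x, y, z⟩ | ⟨x, y, z⟩ | ⟨x, y, z⟩ | ⟨x, y, z⟩ | ⟨x, y, z⟩
  · exact .inl ⟨y, z.symm, x.symm⟩
  · exact .inr (.inr (.inr (.inl ⟨x, y, z⟩)))
  · exact .inr (.inl ⟨y, x, z.symm⟩)
  · exact .inr (.inr (.inl ⟨y, x, z.symm⟩))
  · exact .inr (.inr (.inr (.inr (.inr (.inr ⟨x, y, z⟩)))))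
  · exact .inr (.inr (.inr (.inr (.inl ⟨y, x, z.symm⟩))))
  · exact .inr (.inr (.inr (.inr (.inr (.inl ⟨y, x, z.symm⟩)))))

theorem Pari.swap {a b c : P} (h : Pari a b c) : Pari b a c := by
  rcases h with ⟨x, y, z⟩ | ⟨x, y, z⟩ | ⟨x, y, z⟩ | ⟨x, y, z⟩ | ⟨x, y, z⟩ | ⟨x, y, z⟩ | ⟨x, y, z⟩
  · exact .inl ⟨x.symm, z, y⟩
  · exact .inr (.inr (.inl ⟨x, y, z⟩))
  · exact .inr (.inl ⟨x, y, z⟩)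
  · exact .inr (.inr (.inr (.inl ⟨y, x, z.symm⟩)))
  · exact .inr (.inr (.inr (.inr (.inr (.inl ⟨x, y, z⟩)))))
  · exact .inr (.inr (.inr (.inr (.inl ⟨x, y, z⟩))))
  · exact .inr (.inr (.inr (.inr (.inr (.inr ⟨y, x, z.symm⟩)))))

theorem pari_iff_rot {a b c : P} (hab : a ≠ b) (hbc : b ≠ c) (hac : a ≠ c) :
    Pari a b c ↔ rot a b c = 0 := by
  refine triple_cases (K := fun a b c => Pari a b c ↔ rot a b c = 0) (fun a b c h => ?_)
    (fun a b c h => ?_) (fun a b c x y z => ?_)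
    (fun a b c x y z => ?_) (fun a b c x y z => ?_) (fun a b c x y z => ?_)
    (fun a b c x y => ?_) hab hbc hac
  · rw [rot_cycle, ← h]
    exact ⟨fun h => h.cycle.cycle, Pari.cycle⟩
  · rw [rot_swap, neg_eq_zero, ← h]
    exact ⟨Pari.swap, Pari.swap⟩
  · rw [rot_of_perp x y z]
    simp [Pari, x, y, z]
  · rw [rot_of_min x y z]
    simp [Pari, x, y, z]
  · rw [rot_of_max x y z]
    simp [Pari, x, y, z]
  · rw [rot_of_isolated x y z]
    simp [Pari, x, x.asymm, y.not_lt, y.symm.not_lt, z.not_lt, z.symm.not_lt, not_perp_of_lt]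
  · rw [rot_of_chain x y]
    simp [Pari, x, y, x.asymm, y.asymm, (x.trans y).asymm, not_perp_of_lt, x.trans y]

theorem rot_mem_iff_of_ev {G : Subgroup (Equiv.Perm P)}
    (hE : ∀ g ∈ G, ∀ a b c, a ≠ b → b ≠ c → a ≠ c → Ev a b c → Ev (g a) (g b) (g c))
    {g : Equiv.Perm P} (hg : g ∈ G) (a b c : P) :
    rot (g a) (g b) (g c) = 0 ↔ rot a b c = 0 := by
  by_cases hab : a = b
  · simp [rot_of_eq, hab]
  by_cases hbc : b = c
  · simp [rot_of_eq, hbc]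
  by_cases hac : a = c
  · simp [rot_of_eq, hac]
  rw [← ev_iff_rot hab hbc hac, ← ev_iff_rot (by simpa) (by simpa) (by simpa)]
  refine ⟨fun h => ?_, hE g hg a b c hab hbc hac⟩
  simpa using hE g⁻¹ (G.inv_mem hg) _ _ _ (by simpa) (by simpa) (by simpa) h

theorem Rich.rot_perp_congr {G : Subgroup (Equiv.Perm P)} (R : Rich G) {f : Equiv.Perm P}
    (h : ∀ a b c, rot a b c = 0 → rot (f a) (f b) (f c) = 0) {u v p q : P} (hpu : Perp p u)
    (hpv : Perp p v) (hqu : Perp q u) (hqv : Perp q v) :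
    rot (f u) (f v) (f p) = rot (f u) (f v) (f q) := by
  obtain ⟨r, hr⟩ := R.exists_perp {u, v, p, q}
  have key : ∀ p, Perp p u → Perp p v → Perp p r →
      rot (f u) (f v) (f p) = rot (f u) (f v) (f r) := fun p hpu hpv hpr => by
    have c := rot_cocycle (f u) (f v) (f p) (f r)
    rw [h _ _ _ (rot_of_perp hpv.symm hpr (hr v (by simp))),
      h _ _ _ (rot_of_perp hpu.symm hpr (hr u (by simp)))] at c
    linear_combination -c
  rw [key p hpu hpv (hr p (by simp)), key q hqu hqv (hr q (by simp))]

/-- A permutation preserving the vanishing of `rot` preserves `rot` up to a factor. -/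
theorem Rich.exists_rot_eq_mul {G : Subgroup (Equiv.Perm P)} (R : Rich G) {f : Equiv.Perm P}
    (h : ∀ a b c, rot a b c = 0 → rot (f a) (f b) (f c) = 0) :
    ∃ ε : ZMod 3, ∀ a b c, rot (f a) (f b) (f c) = ε * rot a b c := by
  obtain ⟨u₀, -⟩ := R.exists_perp ∅
  obtain ⟨v₀, h₀⟩ := R.exists_lt u₀
  obtain ⟨p₀, hp₀⟩ := R.exists_perp {u₀, v₀}
  have T : ∀ u v, u < v → ∀ p, Perp p u → Perp p v →
      rot (f u) (f v) (f p) = rot (f u₀) (f v₀) (f p₀) := by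
    intro u' v' h'
    refine R.lt_pairs (T := fun u v => ∀ p, Perp p u → Perp p v →
      rot (f u) (f v) (f p) = rot (f u₀) (f v₀) (f p₀)) (fun u v w huv huw hvw t p hpu hpw => ?_)
      (fun u u' w huw huw' huu t p hpu hpw => ?_) h₀ h' fun p hpu hpv =>
        R.rot_perp_congr h hpu hpv (hp₀ _ (by simp)).symm (hp₀ _ (by simp)).symm
    · obtain ⟨q, hq⟩ := R.exists_perp {u, v, w}
      have hqu := (hq u (by simp)).symm
      have hqv := (hq v (by simp)).symm
      have hqw := (hq w (by simp)).symm
      have c := rot_cocycle (f u) (f v) (f w) (f q)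
      rw [h _ _ _ (rot_of_perp hvw hqw.symm hqv.symm), h _ _ _ (rot_of_min huv huw hvw),
        t q hqu hqv] at c
      rw [R.rot_perp_congr h hpu hpw hqu hqw]
      linear_combination -c
    · obtain ⟨q, hq⟩ := R.exists_perp {u, u', w}
      have hqu := (hq u (by simp)).symm
      have hqu' := (hq u' (by simp)).symm
      have hqw := (hq w (by simp)).symm
      have c := rot_cocycle (f u) (f u') (f w) (f q)
      have e : rot u u' w = 0 := by
        rw [← rot_cycle, ← rot_cycle]
        exact rot_of_max huw huw' huu
      rw [h _ _ _ (rot_of_perp huu hqu'.symm hqu.symm), h _ _ _ e, t q hqu hqw] at c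
      rw [R.rot_perp_congr h hpu hpw hqu' hqw]
      linear_combination c
  refine ⟨rot (f u₀) (f v₀) (f p₀), fun a b c => ?_⟩
  by_cases hab : a = b
  · simp [rot_of_eq, hab]
  by_cases hbc : b = c
  · simp [rot_of_eq, hbc]
  by_cases hac : a = c
  · simp [rot_of_eq, hac]
  refine triple_cases (K := fun a b c =>
    rot (f a) (f b) (f c) = rot (f u₀) (f v₀) (f p₀) * rot a b c) (fun a b c x => ?_)
    (fun a b c x => ?_) (fun a b c x y z => ?_) (fun a b c x y z => ?_) (fun a b c x y z => ?_)
    (fun a b c x y z => ?_) (fun u v w x y => ?_) hab hbc hac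
  · rw [rot_cycle (f a), rot_cycle a, x]
  · rw [rot_swap (f a), rot_swap a, x, mul_neg]
  · rw [h _ _ _ (rot_of_perp x y z), rot_of_perp x y z, mul_zero]
  · rw [h _ _ _ (rot_of_min x y z), rot_of_min x y z, mul_zero]
  · rw [h _ _ _ (rot_of_max x y z), rot_of_max x y z, mul_zero]
  · rw [T _ _ x _ y z, rot_of_isolated x y z, mul_one]
  · obtain ⟨q, hq⟩ := R.pt {u, v, w} {u} ∅ (by simp)
    have hqu := hq u (by simp)
    have hqv := hq v (by simp)
    have hqw := hq w (by simp)
    simp [x.not_ge, (x.trans y).not_ge] at hqu hqv hqw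
    have huq : u < q := lt_of_le_not_ge hqu.1 hqu.2
    have c := rot_cocycle (f u) (f v) (f w) (f q)
    rw [h _ _ _ (rot_of_min (x.trans y) huq hqw), h _ _ _ (rot_of_min x huq hqv),
      T _ _ y _ (Perp.symm hqv) (Perp.symm hqw)] at c
    rw [rot_of_chain x y]
    linear_combination -c

theorem Rich.rot_eq_or_eq_neg {G : Subgroup (Equiv.Perm P)} (R : Rich G) {f : Equiv.Perm P}
    (h : ∀ a b c, rot (f a) (f b) (f c) = 0 ↔ rot a b c = 0) :
    (∀ a b c, rot (f a) (f b) (f c) = rot a b c) ∨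
    ∀ a b c, rot (f a) (f b) (f c) = - rot a b c := by
  obtain ⟨ε, hε⟩ := R.exists_rot_eq_mul fun a b c => (h a b c).2
  obtain ⟨u, -⟩ := R.exists_perp ∅
  obtain ⟨v, huv⟩ := R.exists_lt u
  obtain ⟨p, hp⟩ := R.exists_perp {u, v}
  have e : rot u v p = 1 := rot_of_isolated huv (hp u (by simp)).symm (hp v (by simp)).symm
  have n : ε ≠ 0 := by
    rintro rfl
    have := (h u v p).1 (by rw [hε, zero_mul])
    rw [e] at this
    exact one_ne_zero this
  have : ∀ ε : ZMod 3, ε ≠ 0 → ε = 1 ∨ ε = -1 := by decide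
  rcases this ε n with rfl | rfl
  · exact Or.inl (by simpa using hε)
  · exact Or.inr (by simpa using hε)

/-- `f` preserves `rot`. -/
def RotPres (f : Equiv.Perm P) : Prop := ∀ a b c, rot (f a) (f b) (f c) = rot a b c

theorem RotPres.inv {f : Equiv.Perm P} (h : RotPres f) : RotPres f⁻¹ := fun a b c => by
  rw [← h]
  simp

theorem RotPres.mul {f g : Equiv.Perm P} (h : RotPres f) (h' : RotPres g) : RotPres (f * g) :=
  fun a b c => by simp [Equiv.Perm.mul_apply, h _ _ _, h' _ _ _]

theorem IsOrderAuto.sgn_apply {f : Equiv.Perm P} (h : IsOrderAuto f) (a b : P) :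
    sgn (f a) (f b) = sgn a b := by
  rcases eq_or_ne a b with rfl | n
  · rw [sgn_self, sgn_self]
  rcases lt_gt_or_perp n with c | c | c
  · rw [sgn_of_lt c, sgn_of_lt (h.lt_iff.2 c)]
  · rw [sgn_of_gt c, sgn_of_gt (h.lt_iff.2 c)]
  · rw [sgn_of_perp c, sgn_of_perp (h.perp_iff.2 c)]

theorem IsOrderAuto.rotPres {f : Equiv.Perm P} (h : IsOrderAuto f) : RotPres f :=
  fun a b c => by simp only [rot, h.sgn_apply]

theorem sgn_eq_neg_one {a b : P} : sgn a b = -1 ↔ b < a := by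
  rw [sgn_swap, neg_inj, sgn_eq_one]

theorem perp_of_sgn_eq_zero {a b : P} (n : a ≠ b) (h : sgn a b = 0) : Perp a b := by
  rcases lt_gt_or_perp n with c | c | c
  · rw [sgn_of_lt c] at h
    exact absurd h (by decide)
  · rw [sgn_of_gt c] at h
    exact absurd h (by decide)
  · exact c

theorem sgn_cases (a b : P) : sgn a b = 0 ∨ sgn a b = 1 ∨ sgn a b = -1 := by
  generalize sgn a b = x
  revert x
  decide

theorem between_of_rot {u v m : P} (huv : u < v) (h : rot v u m = 1) : u < m ∧ m < v := by
  rw [rot, sgn_of_gt huv] at h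
  rcases sgn_cases u m with s | s | s <;> rcases sgn_cases m v with t | t | t <;>
    rw [s, t] at h <;> first | exact absurd h (by decide) | skip
  · have c := sgn_eq_neg_one.1 t
    rw [sgn_of_lt (huv.trans c)] at s
    exact absurd s (by decide)
  · exact ⟨sgn_eq_one.1 s, sgn_eq_one.1 t⟩
  · have c := sgn_eq_neg_one.1 s
    rw [sgn_of_lt (c.trans huv)] at t
    exact absurd t (by decide)

theorem Rich.exists_split {G : Subgroup (Equiv.Perm P)} (R : Rich G) {g : Equiv.Perm P}
    (hg : g ∈ G) (h : ∀ a b c, rot (g a) (g b) (g c) = 0 ↔ rot a b c = 0) {a b : P}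
    (hab : Perp a b) (hlt : g a < g b) {x p y : P} (hxp : x < p) (hpy : p < y) :
    ∃ k ∈ G, RotPres k ∧ Perp (k p) (k x) ∧ Perp (k p) (k y) := by
  obtain ⟨σ, hσ, aσ, s1, s2, -⟩ := R.exists_swap ∅ hab (by simp)
  obtain ⟨ε, hε⟩ := R.exists_rot_eq_mul fun a b c => (h a b c).2
  have hk : RotPres (g * σ * g⁻¹) := fun x y z => by
    simp only [Equiv.Perm.mul_apply]
    rw [hε, aσ.rotPres, ← hε]
    simp
  obtain ⟨w, hw⟩ := R.exists_perp {g a, g b}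
  have e := hk (g a) (g b) w
  rw [rot_of_isolated hlt (hw _ (by simp)).symm (hw _ (by simp)).symm] at e
  have ka : (g * σ * g⁻¹) (g a) = g b := by simp [s1]
  have kb : (g * σ * g⁻¹) (g b) = g a := by simp [s2]
  rw [ka, kb] at e
  obtain ⟨h1, h2⟩ := between_of_rot hlt e
  have kG : g * σ * g⁻¹ ∈ G := G.mul_mem (G.mul_mem hg hσ) (G.inv_mem hg)
  generalize g * σ * g⁻¹ = k at *
  obtain ⟨τ, hτ, aτ, e⟩ := R.hom ![x, p, y] ![g a, k w, g b] (by
    intro i j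
    fin_cases i <;> fin_cases j <;>
      simp [hxp.le, hpy.le, hxp.not_ge, hpy.not_ge, (hxp.trans hpy).le, (hxp.trans hpy).not_ge,
        h1.le, h2.le, hlt.le, h1.not_ge, h2.not_ge, hlt.not_ge])
  have e0 := e 0
  have e1 := e 1
  have e2 := e 2
  simp at e0 e1 e2
  refine ⟨k⁻¹ * τ, G.mul_mem (G.inv_mem kG) hτ, hk.inv.mul aτ.rotPres, ?_⟩
  simp only [Equiv.Perm.mul_apply, e0, e1, e2]
  rw [Equiv.Perm.inv_eq_iff_eq.2 kb.symm, Equiv.Perm.inv_eq_iff_eq.2 ka.symm,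
    Equiv.Perm.inv_eq_iff_eq.2 (rfl : k w = k w)]
  exact ⟨(hw (g b) (by simp)).symm, (hw (g a) (by simp)).symm⟩

theorem Rich.exists_isolate {G : Subgroup (Equiv.Perm P)} (R : Rich G)
    (h : ∀ x p y : P, x < p → p < y → ∃ k ∈ G, RotPres k ∧ Perp (k p) (k x) ∧ Perp (k p) (k y))
    (F : Set P) [Finite F] {p : P} (hp : p ∉ F) :
    ∃ k ∈ G, RotPres k ∧ ∀ f ∈ F, Perp (k p) (k f) := by
  obtain ⟨y, hy⟩ := R.pt (insert p F) {p} {f ∈ F | p < f} (by simp)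
  obtain ⟨x, hx⟩ := R.pt (insert p F) {f ∈ F | f < p} {p} (by simp)
  have hpy : p < y := by
    have := hy p (by simp)
    refine lt_of_le_not_ge (this.1.2 ⟨p, rfl, le_rfl⟩) fun c => ?_
    obtain ⟨b, ⟨-, hb⟩, hb'⟩ := this.2.1 c
    exact hb.not_ge hb'
  have hxp : x < p := by
    have := hx p (by simp)
    refine lt_of_le_not_ge (this.2.2 ⟨p, rfl, le_rfl⟩) fun c => ?_
    obtain ⟨b, ⟨-, hb⟩, hb'⟩ := this.1.1 c
    exact hb.not_ge hb'
  obtain ⟨k, hk, rk, k1, k2⟩ := h x p y hxp hpy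
  refine ⟨k, hk, rk, fun f hf => ?_⟩
  have n : p ≠ f := fun e => hp (e ▸ hf)
  obtain ⟨y1, y2⟩ := hy f (by simp [hf])
  obtain ⟨x1, x2⟩ := hx f (by simp [hf])
  have hyf : sgn y f = sgn p f := by
    rcases lt_gt_or_perp n with c | c | c
    · rw [sgn_of_lt c, sgn_of_lt]
      refine lt_of_le_not_ge (y2.2 ⟨f, ⟨hf, c⟩, le_rfl⟩) fun d => ?_
      obtain ⟨_, rfl, e⟩ := y1.1 d
      exact c.not_ge e
    · rw [sgn_of_gt c, sgn_of_gt (c.trans hpy)]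
    · rw [sgn_of_perp c, sgn_of_perp]
      refine ⟨fun d => ?_, fun d => ?_⟩
      · obtain ⟨b, ⟨-, e⟩, e'⟩ := y2.1 d
        exact c.1 (e.le.trans e')
      · obtain ⟨_, rfl, e⟩ := y1.1 d
        exact c.2 e
  have hxf : sgn x f = sgn p f := by
    rcases lt_gt_or_perp n with c | c | c
    · rw [sgn_of_lt c, sgn_of_lt (hxp.trans c)]
    · rw [sgn_of_gt c, sgn_of_gt]
      refine lt_of_le_not_ge (x1.2 ⟨f, ⟨hf, c⟩, le_rfl⟩) fun d => ?_
      obtain ⟨_, rfl, e⟩ := x2.1 d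
      exact c.not_ge e
    · rw [sgn_of_perp c, sgn_of_perp]
      refine ⟨fun d => ?_, fun d => ?_⟩
      · obtain ⟨_, rfl, e⟩ := x2.1 d
        exact c.1 e
      · obtain ⟨b, ⟨-, e⟩, e'⟩ := x1.1 d
        exact c.2 (e'.trans e.le)
  have r1 := rk p y f
  have r2 := rk p x f
  rw [rot, rot, sgn_of_lt hpy, sgn_of_perp k2, hyf, sgn_swap f p] at r1
  rw [rot, rot, sgn_of_gt hxp, sgn_of_perp k1, hxf, sgn_swap f p] at r2
  rw [sgn_swap (k f) (k p)] at r1 r2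
  refine perp_of_sgn_eq_zero (by simpa) ?_
  rcases sgn_cases (k p) (k f) with s | s | s
  · exact s
  · rw [s] at r1
    have c : sgn (k y) (k f) = -1 := by
      linear_combination (exp := 1) r1 + (by decide : (3 : ZMod 3) = 0)
    exact absurd ((sgn_eq_one.1 s).trans (sgn_eq_neg_one.1 c)).le k2.1
  · rw [s] at r2
    have c : sgn (k x) (k f) = 1 := by
      linear_combination (exp := 1) r2 - (by decide : (3 : ZMod 3) = 0)
    exact absurd ((sgn_eq_one.1 c).trans (sgn_eq_neg_one.1 s)).le k1.2

theorem le_iff_eq_or_sgn {a b : P} : a ≤ b ↔ a = b ∨ sgn a b = 1 := by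
  rw [sgn_eq_one, le_iff_eq_or_lt]

theorem Rich.mem_of_rotPres {G : Subgroup (Equiv.Perm P)} (R : Rich G) (hG : IsClosedSubgroup G)
    (h : ∀ x p y : P, x < p → p < y → ∃ k ∈ G, RotPres k ∧ Perp (k p) (k x) ∧ Perp (k p) (k y))
    {f : Equiv.Perm P} (hf : RotPres f) : f ∈ G := by
  refine hG f fun S => ?_
  obtain ⟨p, hp⟩ := R.exists_perp (S : Set P)
  have hpS : p ∉ (S : Set P) := fun c => (hp p c).ne rfl
  obtain ⟨k, hk, rk, ik⟩ := R.exists_isolate h S hpS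
  obtain ⟨l, hl, rl, il⟩ := R.exists_isolate h (f '' S) (p := f p) (by simpa using hpS)
  have e : ∀ s ∈ S, ∀ t ∈ S, sgn (l (f s)) (l (f t)) = sgn (k s) (k t) := fun s hs t ht => by
    have := (rk p s t).trans ((hf p s t).symm.trans (rl _ _ _).symm)
    rw [rot, rot, sgn_of_perp (ik s hs), sgn_of_perp (ik t ht).symm,
      sgn_of_perp (il (f s) ⟨s, hs, rfl⟩), sgn_of_perp (il (f t) ⟨t, ht, rfl⟩).symm] at this
    simpa using this.symm
  obtain ⟨τ, hτ, -, eτ⟩ := R.hom (fun s : S => k s) (fun s : S => l (f s)) fun s t => by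
    rw [le_iff_eq_or_sgn, le_iff_eq_or_sgn, e s s.2 t t.2]
    simp
  exact ⟨l⁻¹ * τ * k, G.mul_mem (G.mul_mem (G.inv_mem hl) hτ) hk, fun x hx => by
    simp [eτ ⟨x, hx⟩]⟩

theorem preserves3_cyc_iff {f : Equiv.Perm P} : Preserves3 f Cyc ↔ RotPres f := by
  refine ⟨fun h a b c => ?_, fun h a b c => by rw [cyc_iff_rot, cyc_iff_rot, h]⟩
  have h1 := h a b c
  have h2 := h b a c
  rw [cyc_iff_rot, cyc_iff_rot] at h1 h2
  rw [rot_swap a, rot_swap (f a)] at h2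
  generalize rot a b c = x at *
  generalize rot (f a) (f b) (f c) = y at *
  revert x y
  decide

theorem Pari.ne {a b c : P} (h : Pari a b c) : a ≠ b ∧ b ≠ c ∧ a ≠ c := by
  rcases h with ⟨x, y, z⟩ | ⟨x, y, z⟩ | ⟨x, y, z⟩ | ⟨x, y, z⟩ | ⟨x, y, z⟩ | ⟨x, y, z⟩ | ⟨x, y, z⟩
  · exact ⟨x.ne, y.ne, z.ne⟩
  · exact ⟨x.ne, z.ne, y.ne⟩
  · exact ⟨x.ne', y.ne, z.ne⟩
  · exact ⟨z.ne, y.ne', x.ne'⟩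
  · exact ⟨x.ne', z.ne, y.ne'⟩
  · exact ⟨x.ne, y.ne', z.ne⟩
  · exact ⟨z.ne, y.ne, x.ne⟩

theorem preserves3_pari_iff {f : Equiv.Perm P} :
    Preserves3 f Pari ↔ ∀ a b c, rot (f a) (f b) (f c) = 0 ↔ rot a b c = 0 := by
  refine ⟨fun h a b c => ?_, fun h a b c => ?_⟩
  · by_cases hab : a = b
    · simp [rot_of_eq, hab]
    by_cases hbc : b = c
    · simp [rot_of_eq, hbc]
    by_cases hac : a = c
    · simp [rot_of_eq, hac]
    rw [← pari_iff_rot hab hbc hac, ← pari_iff_rot (by simpa) (by simpa) (by simpa), h a b c]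
  · by_cases n : a ≠ b ∧ b ≠ c ∧ a ≠ c
    · rw [pari_iff_rot n.1 n.2.1 n.2.2, pari_iff_rot (by simpa using n.1) (by simpa using n.2.1)
        (by simpa using n.2.2), h]
    · exact iff_of_false (fun c => n c.ne) fun c => n (by simpa using c.ne)

theorem Rich.cyc_or_pari {G : Subgroup (Equiv.Perm P)} (R : Rich G) (hG : IsClosedSubgroup G)
    (hE : ∀ g ∈ G, ∀ a b c, a ≠ b → b ≠ c → a ≠ c → Ev a b c → Ev (g a) (g b) (g c))
    {g : Equiv.Perm P} (hg : g ∈ G) {a b : P} (hab : Perp a b) (hn : ¬ Perp (g a) (g b)) :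
    (∀ f : Equiv.Perm P, f ∈ G ↔ Preserves3 f Cyc) ∨
    ∀ f : Equiv.Perm P, f ∈ G ↔ Preserves3 f Pari := by
  have hz : ∀ f ∈ G, ∀ a b c, rot (f a) (f b) (f c) = 0 ↔ rot a b c = 0 :=
    fun f hf => rot_mem_iff_of_ev hE hf
  have split : ∀ x p y : P, x < p → p < y →
      ∃ k ∈ G, RotPres k ∧ Perp (k p) (k x) ∧ Perp (k p) (k y) := fun x p y hxp hpy => by
    rcases lt_or_gt_of_not_perp hn (by simpa using hab.ne) with c | c
    · exact R.exists_split hg (hz g hg) hab c hxp hpy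
    · exact R.exists_split hg (hz g hg) hab.symm c hxp hpy
  by_cases h : ∀ f ∈ G, RotPres f
  · exact Or.inl fun f => ⟨fun hf => preserves3_cyc_iff.2 (h f hf),
      fun hf => R.mem_of_rotPres hG split (preserves3_cyc_iff.1 hf)⟩
  · push Not at h
    obtain ⟨l, hl, nl⟩ := h
    have rl := (R.rot_eq_or_eq_neg (hz l hl)).resolve_left nl
    refine Or.inr fun f => ⟨fun hf => preserves3_pari_iff.2 (hz f hf), fun hf => ?_⟩
    rcases R.rot_eq_or_eq_neg (preserves3_pari_iff.1 hf) with c | c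
    · exact R.mem_of_rotPres hG split c
    · have : RotPres (l * f) := fun a b c' => by
        rw [Equiv.Perm.mul_apply, Equiv.Perm.mul_apply, Equiv.Perm.mul_apply, rl, c, neg_neg]
      simpa using G.mul_mem (G.inv_mem hl) (R.mem_of_rotPres hG split this)

/-- The classification of the closed groups containing `Aut(P)`: there are exactly
five of them. -/
theorem classification_of_closed_groups [Countable P] [Infinite P]
    (hU : IsUniversal P) (hH : IsHomogeneous P)
    (G : Subgroup (Equiv.Perm P)) (hG : IsClosedSubgroup G)
    (hAut : ∀ f : Equiv.Perm P, IsOrderAuto f → f ∈ G) :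
    (∀ f : Equiv.Perm P, f ∈ G ↔ IsOrderAuto f) ∨
    (∀ f : Equiv.Perm P, f ∈ G ↔ ∀ a b : P, Perp a b ↔ Perp (f a) (f b)) ∨
    (∀ f : Equiv.Perm P, f ∈ G ↔ Preserves3 (⇑f) Cyc) ∨
    (∀ f : Equiv.Perm P, f ∈ G ↔ Preserves3 (⇑f) Pari) ∨
    G = ⊤ := by
  have R : Rich G := rich_of_universal_of_homogeneous hU hH G hAut
  rcases eq_top_or_nd_nu R hG with h | ⟨t, ht, hD, hN⟩
  · exact Or.inr (Or.inr (Or.inr (Or.inr h)))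
  have S : PerpToPari G := fun a b c hab hbc hac g hg => ev_of_perp R hD hN ht hab hbc hac hg
  by_cases hp : ∀ g ∈ G, ∀ a b, Perp a b → Perp (g a) (g b)
  · rcases auto_or_perp_of_forall_perp R hAut hp with h | h
    · exact Or.inl h
    · exact Or.inr (Or.inl h)
  have hE := (S.perp_or_ev R).resolve_left hp
  push Not at hp
  obtain ⟨g, hg, a, b, hab, hn⟩ := hp
  rcases R.cyc_or_pari hG hE hg hab hn with h | h
  · exact Or.inr (Or.inr (Or.inl h))
  · exact Or.inr (Or.inr (Or.inr (Or.inl h)))
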